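/- arXiv:2206.10752 — 2 statements merged into one kernel-verified Lean document; each statement's English description precedes it below -/
import Mathlib

section
/- Let G be a finite nonabelian 2-group all of whose proper subgroups are abelian, and suppose rdim(G) = 2. Then either G is isomorphic to the quaternion group Q_8, or there exists k ≥ 2 such that G is isomorphic to the semidirect product C_{2^k} ⋊ C_2 in which the generator of C_2 acts on the cyclic group C_{2^k} by the automorphism g ↦ g^{1+2^{k-1}}. -/
/-- `rdim G` is the smallest `n` such that `G` has a faithful `n`-dimensional
complex representation, i.e. an injective group homomorphism `G →* GL n ℂ`. -/
noncomputable def rdim (G : Type*) [Group G] : ℕ :=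
  sInf {n : ℕ | ∃ ρ : G →* GL (Fin n) ℂ, Function.Injective ρ}

/-- `G` is minimally faithful of degree `n` if `rdim G = n` and every proper
subgroup has strictly smaller representation dimension. -/
def MinFaithful (G : Type*) [Group G] (n : ℕ) : Prop :=
  rdim G = n ∧ ∀ H : Subgroup G, H ≠ ⊤ → rdim H < n

theorem sq_central {G : Type*} [Group G] [Finite G] (hp : IsPGroup 2 G)
    (hna : ¬ ∀ a b : G, a * b = b * a)
    (hab : ∀ H : Subgroup G, H ≠ ⊤ → ∀ a b : H, a * b = b * a) (a b : G) : a ^ 2 * b = b * a ^ 2 := by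
  have : Fact (Nat.Prime 2) := ⟨Nat.prime_two⟩
  obtain ⟨n, hn⟩ := IsPGroup.iff_card.1 hp
  have hlt : Subgroup.zpowers b ≠ ⊤ := by
    intro h
    apply hna
    intro x y
    have hx : x ∈ Subgroup.zpowers b := h ▸ Subgroup.mem_top x
    have hy : y ∈ Subgroup.zpowers b := h ▸ Subgroup.mem_top y
    obtain ⟨i, rfl⟩ := hx
    obtain ⟨j, rfl⟩ := hy
    simp only [← zpow_add, add_comm]
  obtain ⟨j, hj⟩ := IsPGroup.iff_card.1 (hp.to_subgroup (Subgroup.zpowers b))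
  have hjn : j < n := by
    by_contra hc
    apply hlt
    apply Subgroup.eq_top_of_le_card
    rw [hj, hn]
    exact Nat.pow_le_pow_right (by norm_num) (by omega)
  obtain ⟨m, rfl⟩ : ∃ m, n = m + 1 := ⟨n - 1, by omega⟩
  obtain ⟨K, hK, hbK⟩ := Sylow.exists_subgroup_card_pow_prime_le 2 (n := j) (m := m)
    (hn ▸ pow_dvd_pow 2 (by omega)) (Subgroup.zpowers b) hj (by omega)
  have hi : K.index = 2 := by
    have := K.card_mul_index
    rw [hK, hn, pow_succ] at this
    exact Nat.eq_of_mul_eq_mul_left (by positivity) this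
  have hKt : K ≠ ⊤ := by
    rintro rfl
    simp at hi
  have := hab K hKt ⟨a ^ 2, Subgroup.sq_mem_of_index_two hi a⟩ ⟨b, hbK (Subgroup.mem_zpowers b)⟩
  simpa using this

theorem mat_aux (A B Z : Matrix (Fin 2) (Fin 2) ℂ) (h : A * B ≠ B * A) (h1 : Z * A = A * Z)
    (h2 : Z * B = B * Z) : Z 0 1 = 0 ∧ Z 1 0 = 0 ∧ Z 0 0 = Z 1 1 := by
  rw [← Matrix.ext_iff] at h1 h2
  simp only [Matrix.mul_apply, Fin.sum_univ_two, Fin.forall_fin_two] at h1 h2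
  obtain ⟨⟨h11, h12⟩, h13, h14⟩ := h1
  obtain ⟨⟨h21, h22⟩, h23, h24⟩ := h2
  by_contra hc
  apply h
  have key : ∀ t : ℂ, t ≠ 0 → t • (A * B) = t • (B * A) → A * B = B * A := by
    intro t ht h
    exact smul_right_injective _ ht h
  by_cases hq : Z 0 1 = 0
  · by_cases hr : Z 1 0 = 0
    · have hs : Z 0 0 - Z 1 1 ≠ 0 := fun h => hc ⟨hq, hr, sub_eq_zero.1 h⟩
      apply key _ hs
      ext i j
      fin_cases i <;> fin_cases j <;>
        simp [Matrix.mul_apply, Fin.sum_univ_two] <;> grind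
    · apply key _ hr
      ext i j
      fin_cases i <;> fin_cases j <;>
        simp [Matrix.mul_apply, Fin.sum_univ_two] <;> grind
  · apply key _ hq
    ext i j
    fin_cases i <;> fin_cases j <;>
      simp [Matrix.mul_apply, Fin.sum_univ_two] <;> grind

theorem center_cyclic {G : Type*} [Group G] [Finite G] (ρ : G →* GL (Fin 2) ℂ)
    (hρ : Function.Injective ρ) (a b : G) (h : a * b ≠ b * a) :
    IsCyclic (Subgroup.center G) := by
  have key : ∀ z ∈ Subgroup.center G, (ρ z : Matrix (Fin 2) (Fin 2) ℂ) 0 1 = 0 ∧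
      (ρ z : Matrix (Fin 2) (Fin 2) ℂ) 1 0 = 0 ∧
      (ρ z : Matrix (Fin 2) (Fin 2) ℂ) 0 0 = (ρ z : Matrix (Fin 2) (Fin 2) ℂ) 1 1 := by
    intro z hz
    rw [Subgroup.mem_center_iff] at hz
    apply mat_aux (ρ a) (ρ b)
    · intro hh
      apply h
      apply hρ
      apply Units.ext
      simpa using hh
    · rw [← Units.val_mul, ← Units.val_mul, ← map_mul, ← map_mul, hz a]
    · rw [← Units.val_mul, ← Units.val_mul, ← map_mul, ← map_mul, hz b]
  let f : Subgroup.center G →* ℂ :=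
    { toFun := fun z => (ρ z : Matrix (Fin 2) (Fin 2) ℂ) 0 0
      map_one' := by simp
      map_mul' := by
        intro x y
        obtain ⟨h1, -, -⟩ := key x x.2
        simp [Matrix.mul_apply, Fin.sum_univ_two, h1] }
  refine isCyclic_of_injective_ringHom f ?_
  intro x y hxy
  obtain ⟨h1, h2, h3⟩ := key x x.2
  obtain ⟨g1, g2, g3⟩ := key y y.2
  have hxy' : (ρ x : Matrix (Fin 2) (Fin 2) ℂ) 0 0 = (ρ y : Matrix (Fin 2) (Fin 2) ℂ) 0 0 := hxy
  apply Subtype.ext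
  apply hρ
  apply Units.ext
  ext i j
  fin_cases i <;> fin_cases j <;> simp [h1, h2, g1, g2, ← h3, ← g3, hxy']

theorem gen_center {G : Type*} [Group G] [Finite G] (hp : IsPGroup 2 G)
    (hc : IsCyclic (Subgroup.center G)) (z : G) (hz : z ∈ Subgroup.center G)
    (hns : ∀ u ∈ Subgroup.center G, z ≠ u ^ 2) :
    ∀ y ∈ Subgroup.center G, ∃ i : ℤ, y = z ^ i := by
  have : Fact (Nat.Prime 2) := ⟨Nat.prime_two⟩
  obtain ⟨⟨g, hgc⟩, hg⟩ := hc.exists_generator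
  have hg' : ∀ y ∈ Subgroup.center G, ∃ i : ℤ, y = g ^ i := by
    intro y hy
    obtain ⟨i, hi⟩ := hg ⟨y, hy⟩
    refine ⟨i, ?_⟩
    have := congrArg Subtype.val hi
    simpa using this.symm
  obtain ⟨i, hi⟩ := hg' z hz
  obtain ⟨m, hm⟩ := IsPGroup.iff_orderOf.1 hp g
  have hodd : Odd i := by
    rw [← Int.not_even_iff_odd]
    rintro ⟨t, ht⟩
    apply hns (g ^ t) (Subgroup.zpow_mem _ hgc t)
    rw [hi, ht, zpow_add, sq]
  have hcop : IsCoprime i ((2 : ℤ) ^ m) := by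
    apply IsCoprime.pow_right
    obtain ⟨t, ht⟩ := hodd
    exact ⟨1, -t, by rw [ht]; ring⟩
  obtain ⟨r, s, hrs⟩ := hcop
  have hgz : g = z ^ r := by
    have h1 : g ^ ((2 : ℤ) ^ m) = 1 := by
      have := pow_orderOf_eq_one g
      rw [hm] at this
      exact_mod_cast this
    calc g = g ^ (r * i + s * 2 ^ m) := by rw [hrs, zpow_one]
      _ = z ^ r := by
        rw [zpow_add, mul_comm s, zpow_mul g _ s, h1, one_zpow, mul_one, hi, mul_comm, zpow_mul]
  intro y hy
  obtain ⟨j, hj⟩ := hg' y hy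
  refine ⟨r * j, ?_⟩
  rw [hj, zpow_mul, ← hgz]

/-- The homomorphism from `ZMod n` sending `1` to `x`. -/
noncomputable def cycHom {H : Type*} [Group H] (n : ℕ) (x : H) (hx : x ^ n = 1) :
    Multiplicative (ZMod n) →* H :=
  AddMonoidHom.toMultiplicativeLeft (ZMod.lift n ⟨zmultiplesHom (Additive H) (Additive.ofMul x), by
    simp [← ofMul_pow, hx]⟩)

theorem cycHom_int {H : Type*} [Group H] (n : ℕ) (x : H) (hx : x ^ n = 1) (i : ℤ) :
    cycHom n x hx (Multiplicative.ofAdd (i : ZMod n)) = x ^ i := by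
  simp [cycHom]

theorem exists_int {n : ℕ} (g : Multiplicative (ZMod n)) :
    ∃ i : ℤ, g = Multiplicative.ofAdd (i : ZMod n) := by
  obtain ⟨i, hi⟩ := ZMod.intCast_surjective g.toAdd
  exact ⟨i, by rw [hi]; rfl⟩

theorem cycHom_inj {H : Type*} [Group H] (n : ℕ) (x : H) (hx : x ^ n = 1) (ho : orderOf x = n)
    (g : Multiplicative (ZMod n)) (h : cycHom n x hx g = 1) : g = 1 := by
  obtain ⟨i, rfl⟩ := exists_int g
  rw [cycHom_int, ← orderOf_dvd_iff_zpow_eq_one, ho] at h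
  rw [(ZMod.intCast_zmod_eq_zero_iff_dvd i n).2 h]
  rfl

theorem quat_iso {G : Type*} [Group G] (x y : G)
    (hgen : ∀ H : Subgroup G, x ∈ H → y ∈ H → H = ⊤)
    (hxy : x * y ≠ y * x) (hx : x ^ 4 = 1) (hy : y ^ 2 = x ^ 2) (hc : y * x * y⁻¹ = x⁻¹) :
    Nonempty (G ≃* QuaternionGroup 2) := by
  have : Fact (Nat.Prime 2) := ⟨Nat.prime_two⟩
  have hx2 : x ^ 2 ≠ 1 := by
    intro h
    apply hxy
    have : x⁻¹ = x := by rw [inv_eq_iff_mul_eq_one, ← sq, h]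
    rw [this] at hc
    exact (mul_inv_eq_iff_eq_mul.1 hc).symm
  have ho : orderOf x = 2 * 2 := by
    have := orderOf_eq_prime_pow (p := 2) (n := 1) (x := x) (by simpa using hx2) (by simpa using hx)
    simpa using this
  let P := cycHom (2 * 2) x hx
  have hP : ∀ i j : ZMod (2 * 2), P (.ofAdd i) * P (.ofAdd j) = P (.ofAdd (i + j)) := by
    intro i j
    rw [← map_mul]; rfl
  have hPy : ∀ i : ZMod (2 * 2), P (.ofAdd i) * y = y * P (.ofAdd (-i)) := by
    intro i
    obtain ⟨i, rfl⟩ := ZMod.intCast_surjective i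
    rw [← Int.cast_neg]
    change cycHom _ _ _ _ * y = y * cycHom _ _ _ _
    rw [cycHom_int, cycHom_int]
    have h := conj_zpow (i := -i) (a := y) (b := x)
    rw [hc, inv_zpow, zpow_neg, inv_inv] at h
    rw [h, zpow_neg]
    group
  have hP2 : y * y = P (.ofAdd 2) := by
    have := cycHom_int (2 * 2) x hx 2
    rw [← sq, hy]
    have h2 : x ^ (2 : ℤ) = x ^ 2 := by norm_cast
    rw [← h2]
    exact this.symm
  let f : QuaternionGroup 2 →* G := MonoidHom.mk'
    (fun q => match q with
      | .a i => P (.ofAdd i)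
      | .xa i => y * P (.ofAdd i)) (by
    rintro (i | i) (j | j)
    · exact (hP i j).symm
    · simp only [QuaternionGroup.a_mul_xa]
      rw [← mul_assoc, hPy, mul_assoc, hP]; congr 3; ring
    · simp only [QuaternionGroup.xa_mul_a]
      rw [mul_assoc, hP]
    · simp only [QuaternionGroup.xa_mul_xa]
      rw [mul_assoc, ← mul_assoc _ y, hPy, mul_assoc y, hP, ← mul_assoc, hP2, hP]
      congr 2; push_cast; ring)
  refine ⟨(MulEquiv.ofBijective f ⟨?_, ?_⟩).symm⟩
  · rw [injective_iff_map_eq_one]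
    rintro (i | i) h
    · have := cycHom_inj _ x hx ho (.ofAdd i) h
      have h0 : i = 0 := this
      rw [h0]; rfl
    · exfalso
      have h' : y * P (.ofAdd i) = 1 := h
      obtain ⟨i, rfl⟩ := ZMod.intCast_surjective i
      have h2 : y = (x ^ i)⁻¹ := by
        rw [← cycHom_int _ x hx i]; exact eq_inv_of_mul_eq_one_left h'
      apply hxy
      rw [h2]
      group
  · rw [← MonoidHom.range_eq_top]
    have h1 : P (.ofAdd 1) = x := by simpa using cycHom_int (2 * 2) x hx 1
    apply hgen
    · exact ⟨.a 1, h1⟩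
    · refine ⟨.xa 0, ?_⟩
      change y * P 1 = y
      simp

theorem zmod2_cases : ∀ g : Multiplicative (ZMod 2), g = 1 ∨ g = Multiplicative.ofAdd 1 := by
  decide

theorem semi_iso {G : Type*} [Group G] (x y : G) (m : ℕ)
    (hgen : ∀ H : Subgroup G, x ∈ H → y ∈ H → H = ⊤)
    (hxy : x * y ≠ y * x) (hx : orderOf x = 2 ^ (m + 2)) (hy : y ^ 2 = 1)
    (hc : y * x * y⁻¹ = x ^ (1 + 2 ^ (m + 1))) :
    ∃ k : ℕ, 2 ≤ k ∧
      ∃ φ : Multiplicative (ZMod 2) →* MulAut (Multiplicative (ZMod (2 ^ k))),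
        (∀ g : Multiplicative (ZMod (2 ^ k)),
          φ (Multiplicative.ofAdd 1) g = g ^ (1 + 2 ^ (k - 1))) ∧
        Nonempty (G ≃* (Multiplicative (ZMod (2 ^ k)) ⋊[φ] Multiplicative (ZMod 2))) := by
  have : Fact (Nat.Prime 2) := ⟨Nat.prime_two⟩
  refine ⟨m + 2, by omega, ?_⟩
  have hx1 : x ^ (2 ^ (m + 2)) = 1 := by rw [← hx, pow_orderOf_eq_one]
  have hpow : ∀ g : Multiplicative (ZMod (2 ^ (m + 2))),
      (g ^ (1 + 2 ^ (m + 1))) ^ (1 + 2 ^ (m + 1)) = g := by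
    intro g
    have h1 : g ^ (2 ^ (m + 2)) = 1 := by
      have := pow_card_eq_one' (x := g)
      rw [Nat.card_congr Multiplicative.toAdd, Nat.card_zmod] at this
      exact this
    rw [← pow_mul]
    have : (1 + 2 ^ (m + 1)) * (1 + 2 ^ (m + 1)) = 2 ^ (m + 2) * (1 + 2 ^ m) + 1 := by ring
    refine (congrArg (g ^ ·) this).trans ?_
    change g ^ (2 ^ (m + 2) * (1 + 2 ^ m) + 1) = g
    have h3 : g ^ (2 ^ (m + 2) * (1 + 2 ^ m)) = 1 := by
      refine (pow_mul g _ _).trans ?_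
      exact (congrArg (· ^ (1 + 2 ^ m)) h1).trans (one_pow _)
    exact (pow_succ g _).trans ((congrArg (· * g) h3).trans (one_mul g))
  let θ : MulAut (Multiplicative (ZMod (2 ^ (m + 2)))) :=
    { toFun := fun g => g ^ (1 + 2 ^ (m + 1))
      invFun := fun g => g ^ (1 + 2 ^ (m + 1))
      left_inv := hpow
      right_inv := hpow
      map_mul' := fun g h => mul_pow g h _ }
  have hθ : θ ^ 2 = 1 := by
    ext1 g
    rw [sq]
    exact hpow g
  have hφ : cycHom 2 θ hθ (Multiplicative.ofAdd 1) = θ := by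
    simpa using cycHom_int 2 θ hθ 1
  have hgy : cycHom 2 y hy (Multiplicative.ofAdd 1) = y := by
    simpa using cycHom_int 2 y hy 1
  have hgx : cycHom _ x hx1 (Multiplicative.ofAdd 1) = x := by
    simpa using cycHom_int _ x hx1 1
  have h2 := zmod2_cases
  refine ⟨cycHom 2 θ hθ, ?_, ?_⟩
  · intro g
    rw [hφ]; rfl
  let F := SemidirectProduct.lift (φ := cycHom 2 θ hθ) (cycHom _ x hx1) (cycHom 2 y hy) (by
    intro g
    rcases h2 g with rfl | rfl
    · ext n; simp
    · rw [hφ, hgy]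
      refine MonoidHom.ext fun n => ?_
      obtain ⟨i, rfl⟩ := exists_int n
      change cycHom _ x hx1 (_ ^ (1 + 2 ^ (m + 1))) = y * cycHom _ x hx1 _ * y⁻¹
      rw [map_pow, cycHom_int, ← conj_zpow, hc, ← zpow_natCast, ← zpow_natCast, ← zpow_mul,
        ← zpow_mul, mul_comm])
  refine ⟨(MulEquiv.ofBijective F ⟨?_, ?_⟩).symm⟩
  · rw [injective_iff_map_eq_one]
    rintro ⟨n, g⟩ h
    have h' : cycHom _ x hx1 n * cycHom 2 y hy g = 1 := h
    rcases h2 g with rfl | rfl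
    · rw [map_one, mul_one] at h'
      rw [cycHom_inj _ x hx1 hx n h']
      rfl
    · exfalso
      rw [hgy] at h'
      obtain ⟨i, rfl⟩ := exists_int n
      rw [cycHom_int] at h'
      apply hxy
      rw [eq_inv_of_mul_eq_one_right h']
      group
  · rw [← MonoidHom.range_eq_top]
    apply hgen
    · exact ⟨SemidirectProduct.inl (.ofAdd 1), by simp only [F, SemidirectProduct.lift_inl, hgx]⟩
    · exact ⟨SemidirectProduct.inr (.ofAdd 1), by simp only [F, SemidirectProduct.lift_inr, hgy]⟩

theorem comm_facts {G : Type*} [Group G] (hsq : ∀ a b : G, a ^ 2 * b = b * a ^ 2) (a b : G) :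
    (∀ x, a * b * a⁻¹ * b⁻¹ * x = x * (a * b * a⁻¹ * b⁻¹)) ∧ (a * b * a⁻¹ * b⁻¹) ^ 2 = 1 := by
  have h1 : a * b * a⁻¹ * b⁻¹ = a ^ 2 * (a⁻¹ * b) ^ 2 * (b⁻¹) ^ 2 := by
    simp only [sq]; group
  have hc : ∀ x, a * b * a⁻¹ * b⁻¹ * x = x * (a * b * a⁻¹ * b⁻¹) := by
    intro x
    have hm : a ^ 2 * (a⁻¹ * b) ^ 2 * (b⁻¹) ^ 2 ∈ Subgroup.center G := by
      refine mul_mem (mul_mem ?_ ?_) ?_ <;> exact Subgroup.mem_center_iff.2 fun g => (hsq _ g).symm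
    rw [h1]
    exact (Subgroup.mem_center_iff.1 hm x).symm
  refine ⟨hc, ?_⟩
  have h2 : (a * b * a⁻¹ * b⁻¹) ^ 2 * b ^ 2 = b ^ 2 := by
    calc (a * b * a⁻¹ * b⁻¹) ^ 2 * b ^ 2
        = (a * b * a⁻¹ * b⁻¹) * ((a * b * a⁻¹ * b⁻¹) * b) * b := by simp only [sq, mul_assoc]
      _ = (a * b * a⁻¹ * b⁻¹) * (b * (a * b * a⁻¹ * b⁻¹)) * b := by rw [hc b]
      _ = a * b ^ 2 * a⁻¹ := by simp only [sq]; group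
      _ = b ^ 2 := by rw [← hsq]; group
  exact mul_eq_right.1 h2

theorem center_le {G : Type*} [Group G] (hsq : ∀ a b : G, a ^ 2 * b = b * a ^ 2) (a b : G)
    (hab : a * b ≠ b * a) (hgen : ∀ H : Subgroup G, a ∈ H → b ∈ H → H = ⊤)
    (N : Subgroup G) (hN : N ≤ Subgroup.center G) (ha : a ^ 2 ∈ N) (hb : b ^ 2 ∈ N)
    (hc : a * b * a⁻¹ * b⁻¹ ∈ N) : Subgroup.center G ≤ N := by
  have hNc : ∀ n ∈ N, ∀ x, n * x = x * n := fun n hn x =>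
    ((Subgroup.mem_center_iff.1 (hN hn)) x).symm
  have hba : b * a = a * b * (a * b * a⁻¹ * b⁻¹)⁻¹ := by
    rw [eq_mul_inv_iff_mul_eq, ← hNc _ hc]; group
  generalize a * b * a⁻¹ * b⁻¹ = c at hc hba
  have key : ∀ g : G, ∃ n ∈ N, g = n ∨ g = a * n ∨ g = b * n ∨ g = a * b * n := by
    intro g
    have hg : g ∈ Subgroup.closure {a, b} := by
      rw [hgen (Subgroup.closure {a, b}) (Subgroup.subset_closure (by simp))
        (Subgroup.subset_closure (by simp))]
      trivial
    have hA : ∀ g, (∃ n ∈ N, g = n ∨ g = a * n ∨ g = b * n ∨ g = a * b * n) →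
        ∃ n ∈ N, a * g = n ∨ a * g = a * n ∨ a * g = b * n ∨ a * g = a * b * n := by
      rintro g ⟨n, hn, rfl | rfl | rfl | rfl⟩
      · exact ⟨g, hn, by tauto⟩
      · exact ⟨a ^ 2 * n, mul_mem ha hn, .inl (by rw [sq, mul_assoc])⟩
      · exact ⟨n, hn, .inr (.inr (.inr (by rw [mul_assoc])))⟩
      · refine ⟨a ^ 2 * n, mul_mem ha hn, .inr (.inr (.inl ?_))⟩
        rw [← mul_assoc b, ← hsq, sq]; simp only [mul_assoc]
    have hB : ∀ g, (∃ n ∈ N, g = n ∨ g = a * n ∨ g = b * n ∨ g = a * b * n) →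
        ∃ n ∈ N, b * g = n ∨ b * g = a * n ∨ b * g = b * n ∨ b * g = a * b * n := by
      rintro g ⟨n, hn, rfl | rfl | rfl | rfl⟩
      · exact ⟨g, hn, by tauto⟩
      · refine ⟨c⁻¹ * n, mul_mem (inv_mem hc) hn, .inr (.inr (.inr ?_))⟩
        rw [← mul_assoc, hba, mul_assoc]
      · exact ⟨b ^ 2 * n, mul_mem hb hn, .inl (by rw [sq, mul_assoc])⟩
      · refine ⟨b ^ 2 * c⁻¹ * n, mul_mem (mul_mem hb (inv_mem hc)) hn, .inr (.inl ?_)⟩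
        rw [← mul_assoc, ← mul_assoc, hba, mul_assoc (a * b), hNc _ (inv_mem hc)]
        simp only [sq, mul_assoc]
    have hM : ∀ k ∈ N, ∀ g, (∃ n ∈ N, g = n ∨ g = a * n ∨ g = b * n ∨ g = a * b * n) →
        ∃ n ∈ N, g * k = n ∨ g * k = a * n ∨ g * k = b * n ∨ g * k = a * b * n := by
      rintro k hk g ⟨n, hn, h⟩
      refine ⟨n * k, mul_mem hn hk, ?_⟩
      rcases h with rfl | rfl | rfl | rfl <;> simp [mul_assoc]
    induction hg using Subgroup.closure_induction_left with
    | one => exact ⟨1, one_mem N, .inl rfl⟩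
    | mul_left x hx y hy ih =>
      rcases hx with rfl | rfl
      · exact hA _ ih
      · exact hB _ ih
    | inv_mul_cancel x hx y hy ih =>
      rcases hx with rfl | rfl
      · have := hM _ (inv_mem ha) _ (hA _ ih)
        rw [← hNc _ (inv_mem ha), show (x ^ 2)⁻¹ * (x * y) = x⁻¹ * y by simp only [sq]; group] at this
        exact this
      · have := hM _ (inv_mem hb) _ (hB _ ih)
        rw [← hNc _ (inv_mem hb), show (x ^ 2)⁻¹ * (x * y) = x⁻¹ * y by simp only [sq]; group] at this
        exact this
  intro z hz
  obtain ⟨n, hn, h⟩ := key z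
  have hzc := Subgroup.mem_center_iff.1 hz
  rcases h with rfl | rfl | rfl | rfl
  · exact hn
  · exfalso
    have := hzc b
    rw [mul_assoc, hNc n hn b, ← mul_assoc, ← mul_assoc] at this
    exact hab (mul_right_cancel this).symm
  · exfalso
    have := hzc a
    rw [mul_assoc, hNc n hn a, ← mul_assoc, ← mul_assoc] at this
    exact hab (mul_right_cancel this)
  · exfalso
    have := hzc a
    rw [mul_assoc (a * b), hNc n hn a, ← mul_assoc a (a * b), ← mul_assoc (a * b) a] at this
    have := mul_right_cancel this
    rw [mul_assoc a b a] at this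
    exact hab (mul_left_cancel this)

theorem exists_good {G : Type*} [Group G] [Finite G] (hsq : ∀ a b : G, a ^ 2 * b = b * a ^ 2)
    (hgen : ∀ a b : G, a * b ≠ b * a → ∀ H : Subgroup G, a ∈ H → b ∈ H → H = ⊤)
    (a b : G) (hab : a * b ≠ b * a) :
    ∃ a b : G, a * b ≠ b * a ∧ ∀ u ∈ Subgroup.center G, a ^ 2 ≠ u ^ 2 := by
  by_contra hcon
  push Not at hcon
  obtain ⟨hc, hc2⟩ := comm_facts hsq a b
  have hc1 : a * b * a⁻¹ * b⁻¹ ≠ 1 := by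
    intro h
    apply hab
    rw [mul_inv_eq_one, mul_inv_eq_iff_eq_mul] at h
    exact h
  have hcc : a * b * a⁻¹ * b⁻¹ ∈ Subgroup.center G :=
    Subgroup.mem_center_iff.2 fun g => (hc g).symm
  let sq0 : Subgroup.center G →* Subgroup.center G :=
    { toFun := fun u => u ^ 2
      map_one' := one_pow 2
      map_mul' := fun u v => Commute.mul_pow (Subtype.ext (Subgroup.mem_center_iff.1 v.2 u)) 2 }
  let sqh : Subgroup.center G →* G := (Subgroup.center G).subtype.comp sq0
  have hmem : ∀ x, x ∈ sqh.range ↔ ∃ u ∈ Subgroup.center G, x = u ^ 2 := by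
    intro x
    constructor
    · rintro ⟨u, rfl⟩
      exact ⟨u, u.2, rfl⟩
    · rintro ⟨u, hu, rfl⟩
      exact ⟨⟨u, hu⟩, rfl⟩
  have ha := (hmem _).2 (hcon a b hab)
  have hb := (hmem _).2 (hcon b a hab.symm)
  have habb : a * b * b ≠ b * (a * b) := by
    intro h
    rw [← mul_assoc] at h
    exact hab (mul_right_cancel h)
  have h3 := (hmem _).2 (hcon (a * b) b habb)
  have h4 : a * b * a⁻¹ * b⁻¹ = (a * b) ^ 2 * (b ^ 2)⁻¹ * (a ^ 2)⁻¹ := by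
    have e : (a ^ 2)⁻¹ * b = b * (a ^ 2)⁻¹ := by
      rw [inv_mul_eq_iff_eq_mul, ← mul_assoc, hsq]; group
    have e2 : (b ^ 2)⁻¹ * (a ^ 2)⁻¹ = (a ^ 2)⁻¹ * (b ^ 2)⁻¹ := by
      rw [← mul_inv_rev, ← mul_inv_rev, hsq]
    calc a * b * a⁻¹ * b⁻¹ = a * b * a * ((a ^ 2)⁻¹ * b) * (b ^ 2)⁻¹ := by
          simp only [sq]; group
      _ = _ := by rw [e, mul_assoc _ (b ^ 2)⁻¹, e2]; simp only [sq]; group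
  have h5 : a * b * a⁻¹ * b⁻¹ ∈ sqh.range := by
    rw [h4]
    exact mul_mem (mul_mem h3 (inv_mem hb)) (inv_mem ha)
  have hle : Subgroup.center G ≤ sqh.range :=
    center_le hsq a b hab (hgen a b hab) sqh.range (by
      intro x hx
      obtain ⟨u, hu, rfl⟩ := (hmem x).1 hx
      exact pow_mem hu 2) ha hb h5
  have hsurj : Function.Surjective sq0 := by
    rintro ⟨x, hx⟩
    obtain ⟨u, hu⟩ := hle hx
    exact ⟨u, Subtype.ext hu⟩
  have hinj := Finite.injective_iff_surjective.2 hsurj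
  apply hc1
  have := @hinj ⟨_, hcc⟩ 1 (Subtype.ext (by simpa [sq0] using hc2))
  exact congrArg Subtype.val this

theorem stmt_11 (G : Type*) [Group G] [Finite G] (hp : IsPGroup 2 G)
    (hna : ¬ ∀ a b : G, a * b = b * a)
    (hab : ∀ H : Subgroup G, H ≠ ⊤ → ∀ a b : H, a * b = b * a)
    (h2 : rdim G = 2) :
    Nonempty (G ≃* QuaternionGroup 2) ∨
    ∃ k : ℕ, 2 ≤ k ∧
      ∃ φ : Multiplicative (ZMod 2) →* MulAut (Multiplicative (ZMod (2 ^ k))),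
        (∀ g : Multiplicative (ZMod (2 ^ k)),
          φ (Multiplicative.ofAdd 1) g = g ^ (1 + 2 ^ (k - 1))) ∧
        Nonempty (G ≃* (Multiplicative (ZMod (2 ^ k)) ⋊[φ] Multiplicative (ZMod 2))) := by
  have : Fact (Nat.Prime 2) := ⟨Nat.prime_two⟩
  have hsq := sq_central hp hna hab
  have hsqc : ∀ x : G, x ^ 2 ∈ Subgroup.center G := fun x =>
    Subgroup.mem_center_iff.2 fun g => (hsq x g).symm
  have hgen : ∀ a b : G, a * b ≠ b * a → ∀ H : Subgroup G, a ∈ H → b ∈ H → H = ⊤ := by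
    intro a b h H ha hb
    by_contra hH
    exact h (congrArg Subtype.val (hab H hH ⟨a, ha⟩ ⟨b, hb⟩))
  obtain ⟨ρ, hρ⟩ : ∃ ρ : G →* GL (Fin 2) ℂ, Function.Injective ρ := by
    have hne : {n : ℕ | ∃ ρ : G →* GL (Fin n) ℂ, Function.Injective ρ}.Nonempty := by
      by_contra hne
      rw [Set.not_nonempty_iff_eq_empty] at hne
      rw [rdim, hne] at h2
      simp at h2
    have := Nat.sInf_mem hne
    change sInf _ = 2 at h2
    rw [h2] at this
    exact this
  push Not at hna
  obtain ⟨a0, b0, hab0⟩ := hna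
  have hcyc := center_cyclic ρ hρ a0 b0 hab0
  obtain ⟨a, b, hne, hns⟩ := exists_good hsq hgen a0 b0 hab0
  have hgenZ := gen_center hp hcyc _ (hsqc a) hns
  -- the semidirect product conclusion from a noncentral involution
  have fin : ∀ y : G, a * y ≠ y * a → y ^ 2 = 1 → ∃ k : ℕ, 2 ≤ k ∧
      ∃ φ : Multiplicative (ZMod 2) →* MulAut (Multiplicative (ZMod (2 ^ k))),
        (∀ g : Multiplicative (ZMod (2 ^ k)),
          φ (Multiplicative.ofAdd 1) g = g ^ (1 + 2 ^ (k - 1))) ∧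
        Nonempty (G ≃* (Multiplicative (ZMod (2 ^ k)) ⋊[φ] Multiplicative (ZMod 2))) := by
    intro y hay hy
    obtain ⟨hc, hc2⟩ := comm_facts hsq y a
    have hcc : y * a * y⁻¹ * a⁻¹ ∈ Subgroup.center G :=
      Subgroup.mem_center_iff.2 fun g => (hc g).symm
    have hc1 : y * a * y⁻¹ * a⁻¹ ≠ 1 := by
      intro h
      apply hay
      rw [mul_inv_eq_one, mul_inv_eq_iff_eq_mul] at h
      exact h.symm
    obtain ⟨i, hi⟩ := hgenZ _ hcc
    have hyy : y * a * y⁻¹ = (y * a * y⁻¹ * a⁻¹) * a := by group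
    obtain ⟨k, hk⟩ := IsPGroup.iff_orderOf.1 hp a
    have hk2 : 2 ≤ k := by
      by_contra hlt
      apply hc1
      have : a ^ 2 = 1 := by
        rw [← orderOf_dvd_iff_pow_eq_one, hk]
        exact pow_dvd_pow 2 (show k ≤ 1 by omega)
      rw [hi, this, one_zpow]
    obtain ⟨m, rfl⟩ : ∃ m, k = m + 2 := ⟨k - 2, by omega⟩
    have hi' : y * a * y⁻¹ * a⁻¹ = a ^ (2 * i) := by
      rw [hi, zpow_mul, zpow_ofNat]
    rw [hi', ← zpow_natCast, ← zpow_mul, ← orderOf_dvd_iff_zpow_eq_one, hk] at hc2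
    rw [hi', Ne, ← orderOf_dvd_iff_zpow_eq_one, hk] at hc1
    push_cast at hc1 hc2
    have hdvd : (2 : ℤ) ^ m ∣ i := by
      obtain ⟨t, ht⟩ := hc2
      refine ⟨t, ?_⟩
      have : (2 : ℤ) ^ (m + 2) = 4 * 2 ^ m := by ring
      rw [this] at ht
      linarith
    obtain ⟨t, rfl⟩ := hdvd
    rcases Int.even_or_odd' t with ⟨s, rfl | rfl⟩
    · exact absurd ⟨s, by ring⟩ hc1
    · refine semi_iso a y m (hgen a y hay) hay hk hy ?_
      have h1 : a ^ ((2 : ℤ) ^ (m + 2)) = 1 := by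
        have := pow_orderOf_eq_one a
        rw [hk] at this
        exact_mod_cast this
      rw [hyy, hi', show (2 : ℤ) * (2 ^ m * (2 * s + 1)) = 2 ^ (m + 2) * s + 2 ^ (m + 1) by ring,
        zpow_add, zpow_mul, h1, one_zpow, one_mul, add_comm 1, pow_succ a]
      congr 1
      exact_mod_cast zpow_natCast a (2 ^ (m + 1))
  have hmulc : ∀ y w : G, w ∈ Subgroup.center G → (y * w) ^ 2 = y ^ 2 * w ^ 2 := by
    intro y w hw
    exact Commute.mul_pow (Subgroup.mem_center_iff.1 hw y) 2
  have hmuln : ∀ y w : G, w ∈ Subgroup.center G → a * y ≠ y * a → a * (y * w) ≠ y * w * a := by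
    intro y w hw hy h
    rw [mul_assoc y, ← Subgroup.mem_center_iff.1 hw a, ← mul_assoc, ← mul_assoc] at h
    exact hy (mul_right_cancel h)
  obtain ⟨i, hi⟩ := hgenZ _ (hsqc b)
  rcases Int.even_or_odd' i with ⟨t, rfl | rfl⟩
  · right
    have hw : (a ^ 2) ^ (-t) ∈ Subgroup.center G := zpow_mem (hsqc a) _
    refine fin (b * (a ^ 2) ^ (-t)) (hmuln _ _ hw hne) ?_
    rw [hmulc _ _ hw, hi, ← zpow_natCast ((a ^ 2) ^ (-t)), ← zpow_mul, ← zpow_add]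
    convert zpow_zero (a ^ 2) using 2
    push_cast; ring
  · have hw : (a ^ 2) ^ (-t) ∈ Subgroup.center G := zpow_mem (hsqc a) _
    obtain ⟨d, hd, hd2⟩ : ∃ d : G, a * d ≠ d * a ∧ d ^ 2 = a ^ 2 := by
      refine ⟨b * (a ^ 2) ^ (-t), hmuln _ _ hw hne, ?_⟩
      rw [hmulc _ _ hw, hi, ← zpow_natCast ((a ^ 2) ^ (-t)), ← zpow_mul, ← zpow_add]
      convert zpow_one (a ^ 2) using 2
      push_cast; ring
    have he : a * (a⁻¹ * d) ≠ a⁻¹ * d * a := by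
      intro h
      apply hd
      rw [mul_inv_cancel_left, mul_assoc, eq_inv_mul_iff_mul_eq] at h
      exact h
    obtain ⟨hc, hc2⟩ := comm_facts hsq a d
    have hcc : a * d * a⁻¹ * d⁻¹ ∈ Subgroup.center G :=
      Subgroup.mem_center_iff.2 fun g => (hc g).symm
    have hc1 : a * d * a⁻¹ * d⁻¹ ≠ 1 := by
      intro h
      apply hd
      rw [mul_inv_eq_one, mul_inv_eq_iff_eq_mul] at h
      exact h
    have he2 : (a⁻¹ * d) ^ 2 = a * d * a⁻¹ * d⁻¹ := by
      calc (a⁻¹ * d) ^ 2 = (a ^ 2)⁻¹ * ((a * d * a⁻¹ * d⁻¹) * d ^ 2) := by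
            simp only [sq]; group
        _ = _ := by rw [hc, hd2]; group
    by_cases hs : ∃ u ∈ Subgroup.center G, a * d * a⁻¹ * d⁻¹ = u ^ 2
    · right
      obtain ⟨u, hu, hu2⟩ := hs
      refine fin (a⁻¹ * d * u⁻¹) (hmuln _ _ (inv_mem hu) he) ?_
      rw [hmulc _ _ (inv_mem hu), he2, hu2, inv_pow, mul_inv_cancel]
    · left
      push Not at hs
      obtain ⟨j, hj⟩ := gen_center hp hcyc _ hcc hs _ (hsqc a)
      have hca : a ^ 2 = a * d * a⁻¹ * d⁻¹ := by
        rcases Int.even_or_odd' j with ⟨s, rfl | rfl⟩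
        · exfalso
          rw [zpow_mul, zpow_ofNat, hc2, one_zpow] at hj
          exact hns 1 (one_mem _) (by rw [hj, one_pow])
        · rw [zpow_add, zpow_mul, zpow_ofNat, hc2, one_zpow, zpow_one, one_mul] at hj
          exact hj
      have ha4 : a ^ 4 = 1 := by
        rw [show 4 = 2 * 2 from rfl, pow_mul, hca, hc2]
      refine quat_iso a (a⁻¹ * d) (hgen _ _ he) he ha4 (by rw [he2, hca]) ?_
      have h6 : d * a * d⁻¹ = (a * d * a⁻¹ * d⁻¹)⁻¹ * a := by group
      have h7 : a⁻¹ * d * a * (a⁻¹ * d)⁻¹ = a⁻¹ * (d * a * d⁻¹) * a := by group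
      rw [h7, h6, ← hca]
      group
end

section
/- Let G be a finite nonabelian group that is minimally faithful of degree 3, and suppose the Sylow 2-subgroup of the commutator subgroup [G,G] is noncyclic (i.e., [G,G] contains a subgroup isomorphic to C_2 × C_2). Then there exists k ≥ 1 such that G is isomorphic to the semidirect product (C_2 × C_2) ⋊ C_{3^k}, where the action homomorphism C_{3^k} → Aut(C_2 × C_2) has image of order 3, and the center of G is cyclic of order 3^{k-1}. -/
theorem mat2_invol (M : Matrix (Fin 2) (Fin 2) ℂ) (h : M * M = 1) (hd : M.det = 1) :
    M = 1 ∨ M = -1 := by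
  have e := fun i j => congrFun (congrFun h i) j
  have h00 := e 0 0
  have h01 := e 0 1
  have h10 := e 1 0
  have h11 := e 1 1
  simp [Matrix.mul_apply, Fin.sum_univ_two] at h00 h01 h10 h11
  rw [Matrix.det_fin_two] at hd
  have ht : M 0 0 = M 1 1 := by
    by_contra hne
    have h1 : M 0 0 + M 1 1 = 0 := by
      have : (M 0 0 - M 1 1) * (M 0 0 + M 1 1) = 0 := by linear_combination h00 - h11
      rcases mul_eq_zero.1 this with h | h
      · exact absurd (sub_eq_zero.1 h) hne
      · exact h
    have : (2:ℂ) = 0 := by linear_combination -h00 - hd + M 0 0 * h1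
    norm_num at this
  have hbc : M 0 1 * M 1 0 = 0 := by
    linear_combination (1/2) * h00 - (1/2) * hd - (1/2) * M 0 0 * ht
  have ha : M 0 0 * M 0 0 = 1 := by linear_combination h00 - hbc
  have ha0 : M 0 0 ≠ 0 := by rintro h; simp [h] at ha
  have hb : M 0 1 = 0 := by
    have : M 0 0 * M 0 1 = 0 := by linear_combination (1/2) * h01 + (1/2) * M 0 1 * ht
    exact (mul_eq_zero.1 this).resolve_left ha0
  have hc : M 1 0 = 0 := by
    have : M 0 0 * M 1 0 = 0 := by linear_combination (1/2) * h10 + (1/2) * M 1 0 * ht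
    exact (mul_eq_zero.1 this).resolve_left ha0
  rcases mul_self_eq_one_iff.1 ha with h1 | h1
  · left
    ext i j; fin_cases i <;> fin_cases j <;> simp [hb, hc, h1, ← ht]
  · right
    ext i j; fin_cases i <;> fin_cases j <;> simp [hb, hc, h1, ← ht]

/-- Consequences of embedding into `GL₂(ℂ)`. -/
theorem emb2_char {K : Type*} [Group K] (f : K →* GL (Fin 2) ℂ) (hf : Function.Injective f) :
    ∃ δ : K →* ℂˣ, (∀ x y : K, x * x = 1 → y * y = 1 → x ≠ 1 → y ≠ 1 → δ x = 1 → δ y = 1 → x = y)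
      ∧ (∀ x : K, x * x = 1 → δ x = 1 → ∀ y, x * y = y * x) := by
  have key : ∀ x : K, x * x = 1 → Matrix.GeneralLinearGroup.det (f x) = 1 → x ≠ 1 →
      ((f x : GL (Fin 2) ℂ) : Matrix (Fin 2) (Fin 2) ℂ) = -1 := by
    intro x hx hd h1
    have h2 : ((f x : GL (Fin 2) ℂ) : Matrix (Fin 2) (Fin 2) ℂ) * (f x : GL (Fin 2) ℂ) = 1 := by
      rw [← Units.val_mul, ← map_mul, hx, map_one, Units.val_one]
    have h3 : ((f x : GL (Fin 2) ℂ) : Matrix (Fin 2) (Fin 2) ℂ).det = 1 := by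
      have := congrArg Units.val hd
      simpa using this
    rcases mat2_invol _ h2 h3 with h | h
    · exact absurd (hf (by rw [map_one]; exact Units.ext h)) h1
    · exact h
  refine ⟨Matrix.GeneralLinearGroup.det.comp f, ?_, ?_⟩
  · intro x y hx hy hx1 hy1 hdx hdy
    apply hf
    apply Units.ext
    rw [key x hx hdx hx1, key y hy hdy hy1]
  · intro x hx hdx y
    by_cases h1 : x = 1
    · simp [h1]
    apply hf
    apply Units.ext
    rw [map_mul, map_mul, Units.val_mul, Units.val_mul, key x hx hdx h1]
    simp

theorem gl1_to_gl2 : ∃ j : GL (Fin 1) ℂ →* GL (Fin 2) ℂ, Function.Injective j := by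
  refine ⟨(Units.map (Matrix.scalar (Fin 2) : ℂ →+* Matrix (Fin 2) (Fin 2) ℂ).toMonoidHom).comp
    Matrix.GeneralLinearGroup.det, ?_⟩
  intro A B h
  have h1 := congrArg (fun M : GL (Fin 2) ℂ => (M : Matrix (Fin 2) (Fin 2) ℂ) 0 0) h
  simp at h1
  apply Units.ext
  ext i j
  fin_cases i; fin_cases j
  exact h1

theorem commutator_hom_one {G M : Type*} [Group G] [CommMonoid M] (f : G →* M) (x : G)
    (hx : x ∈ commutator G) : f x = 1 := by
  have := Abelianization.commutator_subset_ker f.toHomUnits hx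
  have h2 : f.toHomUnits x = 1 := this
  have := congrArg Units.val h2
  simpa using this

theorem end_dim2 {U : Type*} [AddCommGroup U] [Module ℂ U] (hU : Module.finrank ℂ U = 2)
    (f : Module.End ℂ U) (h : f * f = 1) (hd : LinearMap.det f = 1) : f = 1 ∨ f = -1 := by
  have : FiniteDimensional ℂ U := Module.finite_of_finrank_pos (by omega)
  let b := Module.finBasisOfFinrankEq ℂ U hU
  have hm := mat2_invol (LinearMap.toMatrix b b f)
    (by rw [← LinearMap.toMatrix_mul, h, LinearMap.toMatrix_one]) (by rwa [LinearMap.det_toMatrix])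
  rcases hm with hm | hm
  · left
    apply (LinearMap.toMatrix b b).injective
    rw [hm, LinearMap.toMatrix_one]
  · right
    apply (LinearMap.toMatrix b b).injective
    rw [hm, map_neg, LinearMap.toMatrix_one]

theorem end_dim1 {U : Type*} [AddCommGroup U] [Module ℂ U] (hU : Module.finrank ℂ U = 1)
    (f : Module.End ℂ U) (hd : LinearMap.det f = 1) : f = 1 := by
  obtain ⟨v, hv0, hv⟩ := finrank_eq_one_iff'.1 hU
  obtain ⟨c, hc⟩ := hv (f v)
  have : f = c • LinearMap.id := by
    ext w
    obtain ⟨d, rfl⟩ := hv w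
    rw [map_smul, ← hc, smul_comm]; rfl
  rw [this, LinearMap.det_smul, hU] at hd
  simp at hd
  rw [this, hd]; simp; rfl

def subrep {G E : Type*} [Group G] [AddCommGroup E] [Module ℂ E] (r : G →* Module.End ℂ E)
    (U : Submodule ℂ E) (hU : ∀ g, ∀ u ∈ U, r g u ∈ U) : G →* Module.End ℂ U where
  toFun g := (r g).restrict (hU g)
  map_one' := by ext; simp
  map_mul' := by intro g h; ext; simp

theorem red_case {G E : Type*} [Group G] [AddCommGroup E] [Module ℂ E] (r : G →* Module.End ℂ E)
    (hr : Function.Injective r) (U W : Submodule ℂ E) (hU : ∀ g, ∀ u ∈ U, r g u ∈ U)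
    (hW : ∀ g, ∀ u ∈ W, r g u ∈ W) (hUW : U ⊔ W = ⊤) (h1 : Module.finrank ℂ U = 1)
    (h2 : Module.finrank ℂ W = 2) (x y : G) (hx : x ∈ commutator G) (hy : y ∈ commutator G)
    (hxx : x * x = 1) (hyy : y * y = 1) (hx1 : x ≠ 1) (hy1 : y ≠ 1) : x = y := by
  have key : ∀ x : G, x ∈ commutator G → x * x = 1 → x ≠ 1 →
      (∀ u ∈ U, r x u = u) ∧ (∀ w ∈ W, r x w = -w) := by
    intro x hx hxx hx1
    have a1 : subrep r U hU x = 1 := end_dim1 h1 _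
      (commutator_hom_one ((LinearMap.det : Module.End ℂ U →* ℂ).comp (subrep r U hU)) x hx)
    have a2 : subrep r W hW x = 1 ∨ subrep r W hW x = -1 := end_dim2 h2 _
      (by rw [← map_mul, hxx, map_one])
      (commutator_hom_one ((LinearMap.det : Module.End ℂ W →* ℂ).comp (subrep r W hW)) x hx)
    have b1 : ∀ u ∈ U, r x u = u := fun u hu => by
      have := congrArg Subtype.val (LinearMap.congr_fun a1 ⟨u, hu⟩)
      exact this
    refine ⟨b1, ?_⟩
    rcases a2 with a2 | a2
    · exfalso
      apply hx1
      apply hr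
      rw [map_one]
      ext e
      obtain ⟨u, hu, w, hw, rfl⟩ := Submodule.mem_sup.1 (hUW ▸ Submodule.mem_top : e ∈ U ⊔ W)
      have : r x w = w := congrArg Subtype.val (LinearMap.congr_fun a2 ⟨w, hw⟩)
      simp [b1 u hu, this]
    · intro w hw
      exact congrArg Subtype.val (LinearMap.congr_fun a2 ⟨w, hw⟩)
  obtain ⟨p, q⟩ := key x hx hxx hx1
  obtain ⟨p', q'⟩ := key y hy hyy hy1
  apply hr
  ext e
  obtain ⟨u, hu, w, hw, rfl⟩ := Submodule.mem_sup.1 (hUW ▸ Submodule.mem_top : e ∈ U ⊔ W)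
  simp [p u hu, p' u hu, q w hw, q' w hw]

theorem gl3_central {G : Type*} [Group G] (ρ : G →* GL (Fin 3) ℂ) (hρ : Function.Injective ρ)
    (z : G) (hz : z ∈ commutator G) (hzc : ∀ g, z * g = g * z) (hzz : z * z = 1) (hz1 : z ≠ 1)
    (x y : G) (hx : x ∈ commutator G) (hy : y ∈ commutator G)
    (hxx : x * x = 1) (hyy : y * y = 1) (hx1 : x ≠ 1) (hy1 : y ≠ 1) : x = y := by
  let r : G →* Module.End ℂ (Fin 3 → ℂ) :=
    ((Matrix.toLinAlgEquiv' : Matrix (Fin 3) (Fin 3) ℂ ≃ₐ[ℂ] _) : Matrix (Fin 3) (Fin 3) ℂ →* Module.End ℂ (Fin 3 → ℂ)).comp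
      ((Units.coeHom _).comp ρ)
  have hr : Function.Injective r := by
    intro a b hab
    apply hρ
    apply Units.ext
    exact (Matrix.toLinAlgEquiv' : Matrix (Fin 3) (Fin 3) ℂ ≃ₐ[ℂ] _).injective hab
  have hZ2 : ∀ e, r z (r z e) = e := fun e => by
    have : (r z * r z) e = e := by rw [← map_mul, hzz, map_one]; rfl
    exact this
  have hcomm : ∀ g e, r z (r g e) = r g (r z e) := fun g e => by
    have : (r z * r g) e = (r g * r z) e := by rw [← map_mul, hzc, map_mul]
    exact this
  let U : Submodule ℂ (Fin 3 → ℂ) := LinearMap.ker (r z - 1)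
  let W : Submodule ℂ (Fin 3 → ℂ) := LinearMap.ker (r z + 1)
  have mU : ∀ e, e ∈ U ↔ r z e = e := fun e => by
    simp [U, sub_eq_zero]
  have mW : ∀ e, e ∈ W ↔ r z e = -e := fun e => by
    simp [W, add_eq_zero_iff_eq_neg]
  have hU : ∀ g, ∀ u ∈ U, r g u ∈ U := fun g u hu => by
    rw [mU] at hu ⊢; rw [hcomm, hu]
  have hW : ∀ g, ∀ u ∈ W, r g u ∈ W := fun g u hu => by
    rw [mW] at hu ⊢; rw [hcomm, hu, map_neg]
  have hsup : U ⊔ W = ⊤ := by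
    rw [eq_top_iff]
    intro e _
    refine Submodule.mem_sup.2 ⟨(1/2 : ℂ) • (e + r z e), ?_, (1/2 : ℂ) • (e - r z e), ?_, ?_⟩
    · rw [mU]; simp [hZ2, add_comm]
    · rw [mW]; simp [hZ2, ← smul_neg]
    · rw [← smul_add, add_add_sub_cancel, ← two_smul ℂ, smul_smul]; norm_num
  have hinf : U ⊓ W = ⊥ := by
    rw [eq_bot_iff]
    rintro e ⟨h1, h2⟩
    have h1 := (mU e).1 h1
    have h2 := (mW e).1 h2
    rw [h1] at h2
    simpa using self_eq_neg.1 h2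
  have hfr : Module.finrank ℂ U + Module.finrank ℂ W = 3 := by
    have := Submodule.finrank_sup_add_finrank_inf_eq U W
    rw [hsup, hinf] at this
    simp at this
    omega
  have hU3 : Module.finrank ℂ U ≠ 3 := by
    intro h
    have : U = ⊤ := Submodule.eq_top_of_finrank_eq (by simpa using h)
    apply hz1
    apply hr
    rw [map_one]
    ext1 e
    ext1
    rw [LinearMap.comp_apply, (mU _).1 (this ▸ Submodule.mem_top)]; rfl
  have hW3 : Module.finrank ℂ W ≠ 3 := by
    intro h
    have : W = ⊤ := Submodule.eq_top_of_finrank_eq (by simpa using h)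
    have hneg : r z = (-1 : ℂ) • LinearMap.id := by
      refine LinearMap.ext fun e => ?_
      rw [(mW _).1 (this ▸ Submodule.mem_top)]; simp
    have := commutator_hom_one ((LinearMap.det : Module.End ℂ (Fin 3 → ℂ) →* ℂ).comp r) z hz
    rw [MonoidHom.comp_apply, hneg, LinearMap.det_smul] at this
    simp at this
    norm_num at this
  by_cases h : Module.finrank ℂ U = 1
  · exact red_case r hr U W hU hW hsup h (by omega) x y hx hy hxx hyy hx1 hy1
  · have : Module.finrank ℂ U = 2 ∨ Module.finrank ℂ U = 0 := by omega
    rcases this with h | h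
    · exact red_case r hr W U hW hU (by rw [sup_comm]; exact hsup) (by omega) h x y hx hy hxx hyy hx1 hy1
    · omega

/-- `V = {1, a, b, ab}` is a Klein four-group. -/
structure Klein {G : Type*} [Group G] (V : Subgroup G) (a b : G) : Prop where
  a1 : a ≠ 1
  b1 : b ≠ 1
  ab : a ≠ b
  aa : a * a = 1
  bb : b * b = 1
  comm : a * b = b * a
  mem : ∀ v, v ∈ V ↔ v = 1 ∨ v = a ∨ v = b ∨ v = a * b

namespace Klein
variable {G : Type*} [Group G] {V : Subgroup G} {a b : G}

theorem ha (h : Klein V a b) : a ∈ V := (h.mem a).2 (by simp)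
theorem hb (h : Klein V a b) : b ∈ V := (h.mem b).2 (by simp)
theorem hab (h : Klein V a b) : a * b ∈ V := (h.mem _).2 (by simp)
theorem ab1 (h : Klein V a b) : a * b ≠ 1 := fun e => h.ab (by
  rw [← h.bb] at e; exact mul_right_cancel e)
theorem aba (h : Klein V a b) : a * b ≠ a := fun e => h.b1 (by simpa using e)
theorem abb (h : Klein V a b) : a * b ≠ b := fun e => h.a1 (by simpa using e)
theorem a_ab (h : Klein V a b) : a * (a * b) = b := by rw [← mul_assoc, h.aa, one_mul]
theorem b_ab (h : Klein V a b) : b * (a * b) = a := by rw [h.comm, ← mul_assoc, h.bb, one_mul]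
theorem ab_a (h : Klein V a b) : (a * b) * a = b := by rw [mul_assoc, ← h.comm, h.a_ab]
theorem ab_b (h : Klein V a b) : (a * b) * b = a := by rw [mul_assoc, h.bb, mul_one]
theorem abab (h : Klein V a b) : (a * b) * (a * b) = 1 := by rw [← mul_assoc, h.ab_a, h.bb]

theorem symm (h : Klein V a b) : Klein V b a :=
  ⟨h.b1, h.a1, h.ab.symm, h.bb, h.aa, h.comm.symm, fun v => by rw [h.mem, ← h.comm]; tauto⟩

theorem rot (h : Klein V a b) : Klein V a (a * b) :=
  ⟨h.a1, h.ab1, h.aba.symm, h.aa, h.abab, by rw [h.a_ab, h.ab_a],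
    fun v => by rw [h.mem, h.a_ab]; tauto⟩

theorem sq (h : Klein V a b) {v : G} (hv : v ∈ V) : v * v = 1 := by
  rcases (h.mem v).1 hv with rfl | rfl | rfl | rfl
  · simp
  · exact h.aa
  · exact h.bb
  · exact h.abab

theorem cm (h : Klein V a b) {v w : G} (hv : v ∈ V) (hw : w ∈ V) : v * w = w * v := by
  have h1 := h.sq (V.mul_mem hv hw)
  have h2 := h.sq hv
  have h3 := h.sq hw
  calc v * w = (v * w) * ((w * v) * (w * v)) := by rw [h.sq (V.mul_mem hw hv), mul_one]
    _ = v * (w * w) * v * (w * v) := by group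
    _ = w * v := by rw [h3, mul_one, h2, one_mul]

theorem two (h : Klein V a b) {v w : G} (hv : v ∈ V) (hw : w ∈ V) (hv1 : v ≠ 1) (hw1 : w ≠ 1)
    (hvw : v ≠ w) : Klein V v w := by
  rcases (h.mem v).1 hv with rfl | rfl | rfl | rfl
  · exact absurd rfl hv1
  · rcases (h.mem w).1 hw with rfl | rfl | rfl | rfl
    · exact absurd rfl hw1
    · exact absurd rfl hvw
    · exact h
    · exact h.rot
  · rcases (h.mem w).1 hw with rfl | rfl | rfl | rfl
    · exact absurd rfl hw1
    · exact h.symm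
    · exact absurd rfl hvw
    · have := h.symm.rot; rwa [← h.comm] at this
  · rcases (h.mem w).1 hw with rfl | rfl | rfl | rfl
    · exact absurd rfl hw1
    · exact h.rot.symm
    · have := h.symm.rot.symm; rwa [← h.comm] at this
    · exact absurd rfl hvw

theorem exists_ne (h : Klein V a b) (z : G) : ∃ w ∈ V, w ≠ 1 ∧ w ≠ z := by
  by_cases e : a = z
  · exact ⟨b, h.hb, h.b1, fun e' => h.ab (e.trans e'.symm)⟩
  · exact ⟨a, h.ha, h.a1, e⟩

end Klein

/-- Embeddability in `GL₂(ℂ)`. -/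
def Emb2 (K : Type*) [Group K] : Prop := ∃ f : K →* GL (Fin 2) ℂ, Function.Injective f

theorem units_sq {x : ℂˣ} (h : x * x = 1) : x = 1 ∨ x = -1 := by
  have : (x : ℂ) * x = 1 := by rw [← Units.val_mul, h, Units.val_one]
  rcases mul_self_eq_one_iff.1 this with h | h
  · left; exact Units.ext h
  · right; exact Units.ext (by simpa using h)

theorem emb_klein {G : Type*} [Group G] {V : Subgroup G} {a b : G} (hV : Klein V a b)
    (K : Subgroup G) (hVK : V ≤ K) (hK : Emb2 K) :
    ∃ z ∈ V, z ≠ 1 ∧ (∀ k ∈ K, z * k = k * z) ∧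
      (∀ t ∈ K, t * t = 1 → (∀ v ∈ V, t * v = v * t) → t ∈ V) ∧
      ∃ δ : K →* ℂˣ, ∀ t : K, t * t = 1 → t ≠ 1 → (t : G) ≠ z → δ t = -1 := by
  obtain ⟨f, hf⟩ := hK
  obtain ⟨δ, h1, h2⟩ := emb2_char f hf
  have hsq : ∀ t : K, t * t = 1 → δ t = 1 ∨ δ t = -1 := fun t ht =>
    units_sq (by rw [← map_mul, ht, map_one])
  have hz : ∃ z : K, (z : G) ∈ V ∧ z ≠ 1 ∧ δ z = 1 := by
    let a' : K := ⟨a, hVK hV.ha⟩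
    let b' : K := ⟨b, hVK hV.hb⟩
    rcases hsq a' (Subtype.ext hV.aa) with h | h
    · exact ⟨a', hV.ha, fun e => hV.a1 (congrArg Subtype.val e), h⟩
    rcases hsq b' (Subtype.ext hV.bb) with h' | h'
    · exact ⟨b', hV.hb, fun e => hV.b1 (congrArg Subtype.val e), h'⟩
    exact ⟨a' * b', hV.hab, fun e => hV.ab1 (congrArg Subtype.val e), by
      rw [map_mul, h, h']; simp⟩
  obtain ⟨z, hzV, hz1, hzd⟩ := hz
  have hzz : z * z = 1 := Subtype.ext (hV.sq hzV)
  have hneg : ∀ t : K, t * t = 1 → t ≠ 1 → (t : G) ≠ z → δ t = -1 := by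
    intro t ht ht1 htz
    rcases hsq t ht with h | h
    · exact absurd (congrArg Subtype.val (h1 t z ht hzz ht1 hz1 h hzd)) htz
    · exact h
  refine ⟨z, hzV, fun e => hz1 (Subtype.ext e), ?_, ?_, δ, hneg⟩
  · intro k hk
    exact congrArg Subtype.val (h2 z hzz hzd ⟨k, hk⟩)
  · intro t ht htt hc
    by_contra htV
    obtain ⟨w, hwV, hw1, hwz⟩ := hV.exists_ne (z : G)
    have hwd := hneg ⟨w, hVK hwV⟩ (Subtype.ext (hV.sq hwV)) (fun e => hw1 (congrArg Subtype.val e)) hwz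
    have htd := hneg ⟨t, ht⟩ (Subtype.ext htt)
      (fun e => htV (by have : t = 1 := congrArg Subtype.val e
                        rw [this]; exact V.one_mem)) (fun e => htV (by
                          have : t = z := e
                          rw [this]; exact hzV))
    have htwV : t * w ∉ V := fun h => htV ((V.mul_mem_cancel_right hwV).1 h)
    have := hneg (⟨t, ht⟩ * ⟨w, hVK hwV⟩) (Subtype.ext (by
      change (t * w) * (t * w) = 1
      rw [mul_assoc, ← mul_assoc w, ← hc w hwV, mul_assoc t w w, hV.sq hwV, mul_one, htt]))
      (fun e => htwV (by
        have : t * w = 1 := congrArg Subtype.val e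
        rw [this]; exact V.one_mem))
      (fun e => htwV (by
        have : t * w = z := e
        rw [this]; exact hzV))
    rw [map_mul, htd, hwd] at this
    have := congrArg Units.val this
    norm_num at this

theorem transfer_fusion {G : Type*} [Group G] [Finite G] (hperf : commutator G = ⊤)
    (S : Subgroup G) (hodd : Odd S.index) (δ : S →* ℂˣ) (z v : G)
    (hδ : ∀ t : S, t * t = 1 → t ≠ 1 → (t : G) ≠ z → δ t = -1)
    (hvv : v * v = 1) (hv1 : v ≠ 1) : ∃ g, g⁻¹ * v * g = z := by
  classical
  by_contra! hno
  have haux : ∀ (x : G) (n : ℕ) (hm : x⁻¹ * v ^ n * x ∈ S), n = 1 ∨ n = 2 →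
      δ ⟨x⁻¹ * v ^ n * x, hm⟩ = (-1) ^ n := by
    rintro x n hm (rfl | rfl)
    · rw [pow_one (-1 : ℂˣ)]
      apply hδ
      · apply Subtype.ext
        change (x⁻¹ * v ^ 1 * x) * (x⁻¹ * v ^ 1 * x) = 1
        rw [pow_one]
        calc _ = x⁻¹ * (v * v) * x := by simp only [mul_assoc, mul_inv_cancel_left]
          _ = 1 := by rw [hvv]; group
      · intro e
        apply hv1
        have : x⁻¹ * v ^ 1 * x = 1 := congrArg Subtype.val e
        calc v = x * (x⁻¹ * v ^ 1 * x) * x⁻¹ := by group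
          _ = 1 := by rw [this]; group
      · change x⁻¹ * v ^ 1 * x ≠ z
        rw [pow_one]; exact hno _
    · have : (⟨x⁻¹ * v ^ 2 * x, hm⟩ : S) = 1 := Subtype.ext (by
        change x⁻¹ * v ^ 2 * x = 1
        rw [pow_two, hvv]; group)
      rw [this, map_one]; simp
  have hone : MonoidHom.transfer δ v = 1 :=
    commutator_hom_one _ v (hperf ▸ Subgroup.mem_top v)
  have : Fintype (G ⧸ S) := Fintype.ofFinite _
  have : Fintype (Quotient (MulAction.orbitRel (Subgroup.zpowers v) (G ⧸ S))) :=
    Fintype.ofFinite _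
  rw [MonoidHom.transfer_eq_prod_quotient_orbitRel_zpowers_quot] at hone
  have hterm : ∀ q : Quotient (MulAction.orbitRel (Subgroup.zpowers v) (G ⧸ S)),
      δ ⟨q.out.out⁻¹ * v ^ Function.minimalPeriod (v • ·) q.out * q.out.out,
            QuotientGroup.out_conj_pow_minimalPeriod_mem S v q.out⟩ =
        (-1) ^ Function.minimalPeriod (v • ·) q.out := by
    intro q
    have hp : Function.IsPeriodicPt (v • · : G ⧸ S → _) 2 q.out := by
      change v • v • q.out = q.out
      rw [smul_smul, hvv, one_smul]
    exact haux _ _ _ ((Nat.dvd_prime Nat.prime_two).1 hp.minimalPeriod_dvd)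
  rw [Finset.prod_congr rfl (fun q _ => hterm q), Finset.prod_pow_eq_pow_sum] at hone
  have hsum : ∑ q : Quotient (MulAction.orbitRel (Subgroup.zpowers v) (G ⧸ S)),
      Function.minimalPeriod (v • ·) q.out = S.index := by
    rw [Subgroup.index_eq_card, Nat.card_congr (Subgroup.quotientEquivSigmaZMod S v),
      Nat.card_sigma]
    refine Finset.sum_congr rfl fun q _ => ?_
    simp
  rw [hsum] at hone
  rw [hodd.neg_one_pow] at hone
  have := congrArg Units.val hone
  norm_num at this

section
variable {G : Type*} [Group G] {V : Subgroup G} {a b : G}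

theorem normal_nonperfect (hV : Klein V a b) (hVc : V ≤ commutator G)
    (hprop : ∀ K : Subgroup G, K ≠ ⊤ → Emb2 K)
    (hcent : ∀ z ∈ V, z ≠ 1 → ∃ g, z * g ≠ g * z) (hne : commutator G ≠ ⊤) :
    ∀ g, ∀ v ∈ V, MulAut.conj g v ∈ V := by
  obtain ⟨z, hzV, hz1, hzc, hinv, -⟩ := emb_klein hV _ hVc (hprop _ hne)
  have key : ∀ g, MulAut.conj g z ∈ V := by
    intro g
    apply hinv
    · exact (inferInstance : (commutator G).Normal).conj_mem z (hVc hzV) g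
    · rw [← map_mul, hV.sq hzV, map_one]
    · intro v hv
      have h1 := hzc (MulAut.conj g⁻¹ v)
        ((inferInstance : (commutator G).Normal).conj_mem v (hVc hv) g⁻¹)
      have h2 := congrArg (MulAut.conj g) h1
      rw [map_mul, map_mul] at h2
      have h3 : MulAut.conj g (MulAut.conj g⁻¹ v) = v := by simp [mul_assoc]
      rwa [h3] at h2
  obtain ⟨g, hg⟩ := hcent z hzV hz1
  have hne' : z ≠ MulAut.conj g z := by
    intro e
    apply hg
    rw [MulAut.conj_apply] at e
    nth_rewrite 1 [e]
    group
  have hK := hV.two hzV (key g) hz1 (by simpa using hz1) hne'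
  intro h v hv
  have h2 : MulAut.conj h (MulAut.conj g z) ∈ V := by
    rw [← MulAut.mul_apply, ← map_mul]; exact key _
  rcases (hK.mem v).1 hv with rfl | rfl | rfl | rfl
  · rw [map_one]; exact V.one_mem
  · exact key h
  · exact h2
  · rw [map_mul]; exact V.mul_mem (key h) h2

theorem mem_norm_of {G : Type*} [Group G] [Finite G] {V : Subgroup G} {d : G}
    (h : ∀ v ∈ V, MulAut.conj d v ∈ V) : d ∈ Subgroup.normalizer (V : Set G) :=
  Subgroup.mem_normalizer_fintype h

theorem normal_perfect [Finite G] (hV : Klein V a b)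
    (hprop : ∀ K : Subgroup G, K ≠ ⊤ → Emb2 K)
    (hcent : ∀ z ∈ V, z ≠ 1 → ∃ g, z * g ≠ g * z) (hperf : commutator G = ⊤) :
    ∀ g, ∀ v ∈ V, MulAut.conj g v ∈ V := by
  have hp2 : Fact (Nat.Prime 2) := ⟨Nat.prime_two⟩
  by_cases hN : Subgroup.normalizer (V : Set G) = ⊤
  · intro g v hv
    have : g ∈ Subgroup.normalizer (V : Set G) := hN ▸ Subgroup.mem_top g
    exact (Subgroup.mem_normalizer_iff.1 this v).1 hv
  exfalso
  obtain ⟨z0, hz0V, hz01, hz0c, -, -⟩ := emb_klein hV _ Subgroup.le_normalizer (hprop _ hN)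
  obtain ⟨v, hvV, hv1, hvz⟩ := hV.exists_ne z0
  have hK := hV.two hz0V hvV hz01 hv1 hvz.symm
  -- V is a 2-group
  have hV2 : IsPGroup 2 V := fun w => ⟨1, Subtype.ext (by
    have := hV.sq w.2
    simpa [pow_two] using this)⟩
  -- fusion
  have hfus : ∃ g, MulAut.conj g z0 = v := by
    obtain ⟨S, hS⟩ := hV2.exists_le_sylow
    have hSne : (S : Subgroup G) ≠ ⊤ := by
      intro e
      have h2 : IsPGroup 2 G := by
        intro g
        obtain ⟨k, hk⟩ := S.isPGroup' ⟨g, e ▸ Subgroup.mem_top g⟩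
        exact ⟨k, congrArg Subtype.val hk⟩
      have := h2.isNilpotent
      have : Nontrivial G := ⟨a, 1, hV.a1⟩
      exact (Group.IsSolvable.commutator_lt_top_of_nontrivial G).ne hperf
    obtain ⟨z, -, -, -, -, δ, hδ⟩ := emb_klein hV _ hS (hprop _ hSne)
    have hodd : Odd (S : Subgroup G).index := by
      rw [← Nat.not_even_iff_odd, even_iff_two_dvd]
      exact S.not_dvd_index
    obtain ⟨g1, hg1⟩ := transfer_fusion hperf S hodd δ z z0 hδ (hV.sq hz0V) hz01
    obtain ⟨g2, hg2⟩ := transfer_fusion hperf S hodd δ z v hδ (hV.sq hvV) hv1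
    refine ⟨g2 * g1⁻¹, ?_⟩
    rw [MulAut.conj_apply]
    calc _ = g2 * (g1⁻¹ * z0 * g1) * g2⁻¹ := by group
      _ = v := by rw [hg1, ← hg2]; group
  obtain ⟨g, hg⟩ := hfus
  -- centralizer
  have hCtop : Subgroup.centralizer (V : Set G) ≠ ⊤ := by
    intro e
    obtain ⟨g, hg⟩ := hcent v hvV hv1
    have : g ∈ Subgroup.centralizer (V : Set G) := e ▸ Subgroup.mem_top g
    exact hg (Subgroup.mem_centralizer_iff.1 this v hvV)
  have hVC : V ≤ Subgroup.centralizer (V : Set G) := fun x hx =>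
    Subgroup.mem_centralizer_iff.2 fun y hy => hV.cm hy hx
  obtain ⟨-, -, -, -, hinv, -⟩ := emb_klein hV _ hVC (hprop _ hCtop)
  have memC : ∀ x, x * z0 = z0 * x → x * v = v * x → x ∈ Subgroup.centralizer (V : Set G) := by
    intro x h1 h2
    refine Subgroup.mem_centralizer_iff.2 fun y hy => ?_
    rcases (hK.mem y).1 hy with rfl | rfl | rfl | rfl
    · simp
    · exact h1.symm
    · exact h2.symm
    · rw [mul_assoc, ← h2, ← mul_assoc, ← h1, mul_assoc]
  -- maximal 2-subgroup
  obtain ⟨A, hA, hAmax⟩ := (Set.toFinite {A : Subgroup G | V ≤ A ∧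
    A ≤ Subgroup.centralizer (V : Set G) ∧ IsPGroup 2 A}).exists_maximal ⟨V, le_refl _, hVC, hV2⟩
  obtain ⟨hVA, hAC, hA2⟩ := hA
  have hnorm : ∀ d, (∀ x ∈ A, MulAut.conj d x ∈ A) → d ∈ Subgroup.normalizer (V : Set G) := by
    intro d hd
    refine mem_norm_of fun w hw => hinv _ (hAC (hd w (hVA hw))) ?_ ?_
    · rw [← map_mul, hV.sq hw, map_one]
    · intro u hu
      exact (Subgroup.mem_centralizer_iff.1 (hAC (hd w (hVA hw))) u hu).symm
  let Cv := Subgroup.centralizer ({v} : Set G)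
  have memCv : ∀ x, x ∈ Cv ↔ x * v = v * x := fun x => by
    rw [Subgroup.mem_centralizer_iff]; simp [eq_comm]
  have hACv : A ≤ Cv := fun x hx => (memCv x).2
    (Subgroup.mem_centralizer_iff.1 (hAC hx) v hvV).symm
  -- A is a maximal 2-subgroup in Cv
  have hmax : ∀ P : Subgroup G, P ≤ Cv → IsPGroup 2 P → A ≤ P → P = A := by
    intro P hPC hP2 hAP
    by_contra hne
    have hnil : Group.IsNilpotent P := hP2.isNilpotent
    have hnc := Group.normalizerCondition_of_isNilpotent (G := P)
    have hlt : A.subgroupOf P < ⊤ := by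
      rw [lt_top_iff_ne_top]
      intro e
      exact hne (le_antisymm (Subgroup.subgroupOf_eq_top.1 e) hAP)
    obtain ⟨p, hp1, hp2⟩ := SetLike.exists_of_lt (hnc _ hlt)
    have hpA : (p : G) ∉ A := fun h => hp2 (Subgroup.mem_subgroupOf.2 h)
    have hpn : (p : G) ∈ Subgroup.normalizer (V : Set G) := by
      apply hnorm
      intro x hx
      have := (Subgroup.mem_normalizer_iff.1 hp1 ⟨x, hAP hx⟩).1 (Subgroup.mem_subgroupOf.2 hx)
      exact Subgroup.mem_subgroupOf.1 this
    have hpC := memC p (hz0c _ hpn).symm ((memCv _).1 (hPC p.2))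
    have hle : A ⊔ Subgroup.zpowers (p : G) ≤ P :=
      sup_le hAP (by rw [Subgroup.zpowers_le]; exact p.2)
    have h2 := hAmax (y := A ⊔ Subgroup.zpowers (p : G)) ⟨hVA.trans le_sup_left,
      sup_le hAC (by rw [Subgroup.zpowers_le]; exact hpC), hP2.to_le hle⟩ le_sup_left
    exact hpA (h2 ((le_sup_right : _ ≤ A ⊔ Subgroup.zpowers (p : G)) (Subgroup.mem_zpowers _)))
  let Q : Sylow 2 Cv := ⟨A.subgroupOf Cv, hA2.comap_subtype, by
    intro R hR hle
    have h1 := hmax (R.map Cv.subtype) (by rintro _ ⟨x, -, rfl⟩; exact x.2) (hR.map _)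
      (by intro x hx; exact ⟨⟨x, hACv hx⟩, hle (Subgroup.mem_subgroupOf.2 hx), rfl⟩)
    ext x
    rw [Subgroup.mem_subgroupOf, ← h1]
    constructor
    · intro hx; exact ⟨x, hx, rfl⟩
    · rintro ⟨y, hy, e⟩
      rwa [← Subtype.ext e]⟩
  -- the conjugate of A
  let B : Subgroup G := A.map (MulAut.conj g).toMonoidHom
  have hBCv : B ≤ Cv := by
    rintro _ ⟨x, hx, rfl⟩
    rw [memCv, ← hg]
    change MulAut.conj g x * MulAut.conj g z0 = MulAut.conj g z0 * MulAut.conj g x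
    rw [← map_mul, ← map_mul, Subgroup.mem_centralizer_iff.1 (hAC hx) z0 hz0V]
  have hB2 : IsPGroup 2 (B.subgroupOf Cv) := (hA2.map _).comap_subtype
  obtain ⟨R, hR⟩ := hB2.exists_le_sylow
  obtain ⟨c, hc⟩ := MulAction.exists_smul_eq Cv Q R
  have hd : ∀ x ∈ A, MulAut.conj ((c : G)⁻¹ * g) x ∈ A := by
    intro x hx
    have h1 : MulAut.conj g x ∈ B := ⟨x, hx, rfl⟩
    have h2 : (⟨_, hBCv h1⟩ : Cv) ∈ R := hR (Subgroup.mem_subgroupOf.2 h1)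
    rw [← hc] at h2
    have h3 : (⟨_, hBCv h1⟩ : Cv) ∈ ((c • Q : Sylow 2 Cv) : Subgroup Cv) := h2
    rw [Sylow.coe_subgroup_smul] at h3
    obtain ⟨y, hy, e⟩ := h3
    have hy' : (y : G) ∈ A := Subgroup.mem_subgroupOf.1 hy
    have e' : (c : G) * y * (c : G)⁻¹ = g * x * g⁻¹ := congrArg Subtype.val e
    have : MulAut.conj ((c : G)⁻¹ * g) x = y := by
      rw [MulAut.conj_apply]
      calc _ = (c : G)⁻¹ * (g * x * g⁻¹) * c := by group
        _ = y := by rw [← e']; group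
    rwa [this]
  have h1 := hz0c _ (hnorm _ hd)
  have h2 : MulAut.conj ((c : G)⁻¹ * g) z0 = v := by
    rw [map_mul, MulAut.mul_apply, hg, MulAut.conj_apply, inv_inv]
    have := (memCv _).1 c.2
    rw [mul_assoc, ← this]; group
  rw [MulAut.conj_apply, ← h1, mul_inv_cancel_right] at h2
  exact hvz h2.symm

end

section
variable {G : Type*} [Group G] {V : Subgroup G} {a b : G}

theorem cyc_step (hV : Klein V a b) (hn : ∀ g, ∀ v ∈ V, MulAut.conj g v ∈ V) {g : G}
    (h : MulAut.conj g a = b) : MulAut.conj g b = a ∨ MulAut.conj g b = a * b := by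
  rcases (hV.mem _).1 (hn g b hV.hb) with e | e | e | e
  · exact absurd ((MulAut.conj g).injective (e.trans (map_one _).symm)) hV.b1
  · exact Or.inl e
  · exact absurd ((MulAut.conj g).injective (h.trans e.symm)) hV.ab
  · exact Or.inr e

theorem exists_cycle (hV : Klein V a b) (hn : ∀ g, ∀ v ∈ V, MulAut.conj g v ∈ V)
    (hcent : ∀ z ∈ V, z ≠ 1 → ∃ g, z * g ≠ g * z) :
    ∃ x y g, Klein V x y ∧ MulAut.conj g x = y ∧ MulAut.conj g y = x * y := by
  have hc : ∀ z ∈ V, z ≠ 1 → ∃ g, Klein V z (MulAut.conj g z) := by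
    intro z hz hz1
    obtain ⟨g, hg⟩ := hcent z hz hz1
    refine ⟨g, hV.two hz (hn g z hz) hz1 (by simpa using hz1) fun e => hg ?_⟩
    rw [MulAut.conj_apply] at e
    nth_rewrite 1 [e]
    group
  obtain ⟨g, K1⟩ := hc a hV.ha hV.a1
  rcases cyc_step K1 hn rfl with h1 | h1
  swap
  · exact ⟨_, _, g, K1, rfl, h1⟩
  generalize ha' : MulAut.conj g a = a' at *
  obtain ⟨g2, K2⟩ := hc (a * a') K1.hab K1.ab1
  rcases cyc_step K2 hn rfl with h2 | h2
  swap
  · exact ⟨_, _, g2, K2, rfl, h2⟩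
  generalize hc' : MulAut.conj g2 (a * a') = c' at *
  rcases (K1.mem c').1 K2.hb with e | e | e | e
  · exact absurd e K2.b1
  · subst e
    refine ⟨c', a', g2 * g, K1, ?_, ?_⟩
    · rw [map_mul, MulAut.mul_apply, ha']
      rw [← K1.a_ab, map_mul, h2, hc', K1.ab_a, K1.a_ab]
    · rw [map_mul, MulAut.mul_apply, h1, h2]
  · subst e
    refine ⟨c', a, g2 * g, K1.symm, ?_, ?_⟩
    · rw [map_mul, MulAut.mul_apply, h1]
      rw [← K1.b_ab, map_mul, h2, hc', K1.ab_b, K1.b_ab]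
    · rw [map_mul, MulAut.mul_apply, ha', h2, K1.comm]
  · exact absurd e.symm K2.ab

theorem pow_act (hV : Klein V a b) {g : G} (h1 : MulAut.conj g a = b)
    (h2 : MulAut.conj g b = a * b) (q : ℕ) :
    MulAut.conj (g ^ (3 * q)) a = a ∧ MulAut.conj (g ^ (3 * q)) b = b := by
  have h3 : MulAut.conj g (a * b) = a := by rw [map_mul, h1, h2, hV.b_ab]
  induction q with
  | zero => simp
  | succ q ih =>
    have : g ^ (3 * (q + 1)) = g ^ (3 * q) * g * g * g := by
      rw [mul_add, pow_add, mul_one, pow_succ g 2, pow_two]; simp only [mul_assoc]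
    rw [this]
    simp only [map_mul (MulAut.conj : G →* MulAut G), MulAut.mul_apply, h1, h2, h3, ih, and_self]

theorem pow_act1 (hV : Klein V a b) {g : G} (h1 : MulAut.conj g a = b)
    (h2 : MulAut.conj g b = a * b) (q : ℕ) :
    MulAut.conj (g ^ (3 * q + 1)) a = b ∧ MulAut.conj (g ^ (3 * q + 1)) b = a * b := by
  have := pow_act hV h1 h2 q
  rw [pow_add, pow_one]
  simp only [map_mul, MulAut.mul_apply, h1, h2, this, and_self]

theorem pow_act2 (hV : Klein V a b) {g : G} (h1 : MulAut.conj g a = b)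
    (h2 : MulAut.conj g b = a * b) (q : ℕ) :
    MulAut.conj (g ^ (3 * q + 2)) a = a * b ∧ MulAut.conj (g ^ (3 * q + 2)) (a * b) = b := by
  have h3 : MulAut.conj g (a * b) = a := by rw [map_mul, h1, h2, hV.b_ab]
  have := pow_act hV h1 h2 q
  rw [pow_add, pow_two]
  simp only [map_mul (MulAut.conj : G →* MulAut G), MulAut.mul_apply, h1, h2, h3, this, and_true]
  rw [map_mul, this.1, this.2]

theorem three_part [Finite G] (hV : Klein V a b) {g : G} (h1 : MulAut.conj g a = b)
    (h2 : MulAut.conj g b = a * b) :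
    ∃ x y g k, Klein V x y ∧ MulAut.conj g x = y ∧ MulAut.conj g y = x * y ∧
      orderOf g = 3 ^ k := by
  obtain ⟨k, m, hm, he⟩ := Nat.exists_eq_pow_mul_and_not_dvd (orderOf_pos g).ne' 3 (by norm_num)
  have hm0 : m ≠ 0 := by rintro rfl; simp at hm
  have ho : orderOf (g ^ m) = 3 ^ k := by
    rw [orderOf_pow_of_dvd hm0 (he ▸ Dvd.intro_left _ rfl), he,
      Nat.mul_div_cancel _ (Nat.pos_of_ne_zero hm0)]
  have : m = 3 * (m / 3) + 1 ∨ m = 3 * (m / 3) + 2 := by omega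
  rcases this with e | e
  · have := pow_act1 hV h1 h2 (m / 3)
    rw [← e] at this
    exact ⟨a, b, g ^ m, k, hV, this.1, this.2, ho⟩
  · have := pow_act2 hV h1 h2 (m / 3)
    rw [← e] at this
    exact ⟨a, a * b, g ^ m, k, hV.rot, this.1, by rw [this.2, hV.a_ab], ho⟩

theorem not_emb2 (hV : Klein V a b) {g : G} (h1 : MulAut.conj g a = b)
    (h2 : MulAut.conj g b = a * b) : ¬ Emb2 (V ⊔ Subgroup.zpowers g : Subgroup G) := by
  rintro ⟨f, hf⟩
  obtain ⟨δ, d1, -⟩ := emb2_char f hf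
  have hVK : V ≤ V ⊔ Subgroup.zpowers g := le_sup_left
  let g' : (V ⊔ Subgroup.zpowers g : Subgroup G) :=
    ⟨g, (le_sup_right : _ ≤ V ⊔ Subgroup.zpowers g) (Subgroup.mem_zpowers g)⟩
  let a' : (V ⊔ Subgroup.zpowers g : Subgroup G) := ⟨a, hVK hV.ha⟩
  let b' : (V ⊔ Subgroup.zpowers g : Subgroup G) := ⟨b, hVK hV.hb⟩
  have e1 : g' * a' * g'⁻¹ = b' := Subtype.ext h1
  have e2 : g' * b' * g'⁻¹ = a' * b' := Subtype.ext h2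
  have f1 : δ a' = δ b' := by rw [← e1, map_mul, map_mul, map_inv, mul_comm, inv_mul_cancel_left]
  have f2 : δ b' = δ a' * δ b' := by
    rw [← map_mul, ← e2, map_mul, map_mul, map_inv, mul_comm, inv_mul_cancel_left]
  have f3 : δ a' = 1 := by simpa using f2
  exact hV.ab (congrArg Subtype.val (d1 a' b' (Subtype.ext hV.aa) (Subtype.ext hV.bb)
    (fun e => hV.a1 (congrArg Subtype.val e)) (fun e => hV.b1 (congrArg Subtype.val e)) f3
    (f1 ▸ f3)))

theorem final_step [Finite G] {C : Type*} [Group C] (hV : Klein V a b)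
    (hn : ∀ g, ∀ v ∈ V, MulAut.conj g v ∈ V) {g : G}
    (h1 : MulAut.conj g a = b) (h2 : MulAut.conj g b = a * b)
    (htop : V ⊔ Subgroup.zpowers g = ⊤) (k : ℕ) (ho : orderOf g = 3 ^ k) (e : V ≃* C) :
    1 ≤ k ∧ ∃ φ : Multiplicative (ZMod (3 ^ k)) →* MulAut C,
        Nat.card φ.range = 3 ∧
        Nonempty (G ≃* (C ⋊[φ] Multiplicative (ZMod (3 ^ k)))) ∧
        IsCyclic (Subgroup.center G) ∧ Nat.card (Subgroup.center G) = 3 ^ (k - 1) := by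
  have hVn : V.Normal := ⟨fun v hv g => hn g v hv⟩
  have h3 : MulAut.conj g (a * b) = a := by rw [map_mul, h1, h2, hV.b_ab]
  have hk : 1 ≤ k := by
    by_contra h
    have : k = 0 := by omega
    subst this
    rw [pow_zero, orderOf_eq_one_iff] at ho
    subst ho
    exact hV.ab (by simpa using h1)
  -- elements of V commuting with g are trivial
  have hfix : ∀ v ∈ V, MulAut.conj g v = v → v = 1 := by
    intro v hv hg
    rcases (hV.mem v).1 hv with rfl | rfl | rfl | rfl
    · rfl
    · exact absurd (hg.symm.trans h1) hV.ab
    · exact absurd (h2.symm.trans hg) hV.abb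
    · exact absurd (h3.symm.trans hg).symm hV.aba
  have hinter : ∀ v ∈ V, v ∈ Subgroup.zpowers g → v = 1 := by
    intro v hv hg
    apply hfix v hv
    obtain ⟨i, rfl⟩ := Subgroup.mem_zpowers_iff.1 hg
    rw [MulAut.conj_apply]; group
  refine ⟨hk, ?_⟩
  let f : Multiplicative (ZMod (3 ^ k)) ≃* Subgroup.zpowers g :=
    mulEquivOfCyclicCardEq (by
      rw [Nat.card_zpowers, ho]
      simp)
  let φ : Multiplicative (ZMod (3 ^ k)) →* MulAut C :=
    (MulAut.congr e).toMonoidHom.comp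
      ((MulAut.conjNormal : G →* MulAut V).comp ((Subgroup.zpowers g).subtype.comp f.toMonoidHom))
  have hφ : ∀ t c, ((e.symm (φ t c) : V) : G) = f t * (e.symm c : V) * (f t : G)⁻¹ := by
    intro t c
    simp [φ, MulAut.congr]
  refine ⟨φ, ?_, ?_, ?_⟩
  · let γ := f.symm ⟨g, Subgroup.mem_zpowers g⟩
    have hr : φ.range = Subgroup.zpowers (φ γ) := by
      apply le_antisymm
      · rintro _ ⟨t, rfl⟩
        obtain ⟨i, hi⟩ := Subgroup.mem_zpowers_iff.1 (f t).2
        refine Subgroup.mem_zpowers_iff.2 ⟨i, ?_⟩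
        rw [← map_zpow]
        congr 1
        apply f.injective
        rw [map_zpow]
        apply Subtype.ext
        simpa [γ] using hi
      · rw [Subgroup.zpowers_le]; exact ⟨γ, rfl⟩
    have hγ : φ γ = MulAut.congr e (MulAut.conjNormal g) := by
      simp [φ, γ]
    rw [hr, Nat.card_zpowers, hγ, MulEquiv.orderOf_eq]
    have : Fact (Nat.Prime 3) := ⟨Nat.prime_three⟩
    apply orderOf_eq_prime
    · rw [← map_pow]
      have h4 := pow_act hV h1 h2 1
      rw [mul_one] at h4
      ext v
      rw [MulAut.conjNormal_apply]
      change MulAut.conj (g ^ 3) v = v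
      rcases (hV.mem v).1 v.2 with h | h | h | h <;> rw [h]
      · simp
      · exact h4.1
      · exact h4.2
      · rw [map_mul, h4.1, h4.2]
    · intro h
      have := congrArg Subtype.val (DFunLike.congr_fun h ⟨a, hV.ha⟩)
      rw [MulAut.conjNormal_apply] at this
      exact hV.ab (this.symm.trans h1)
  · let F : C ⋊[φ] Multiplicative (ZMod (3 ^ k)) →* G :=
      SemidirectProduct.lift (V.subtype.comp e.symm.toMonoidHom)
        ((Subgroup.zpowers g).subtype.comp f.toMonoidHom) (by
          intro t
          ext c
          exact hφ t c)
    have hF : Function.Bijective F := by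
      constructor
      · rw [injective_iff_map_eq_one]
        rintro ⟨c, t⟩ h
        have h' : ((e.symm c : V) : G) * (f t : G) = 1 := h
        have hm : (f t : G) ∈ V := by
          rw [eq_inv_of_mul_eq_one_right h']; exact V.inv_mem (e.symm c).2
        have ht := hinter _ hm (f t).2
        rw [ht, mul_one] at h'
        have ht' : t = 1 := by
          apply f.injective; rw [map_one]; exact Subtype.ext ht
        have hc' : c = 1 := by
          apply e.symm.injective; rw [map_one]; exact Subtype.ext h'
        rw [ht', hc']; rfl
      · rw [← MonoidHom.range_eq_top, eq_top_iff, ← htop, sup_le_iff]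
        constructor
        · intro v hv
          exact ⟨SemidirectProduct.inl (e ⟨v, hv⟩), by simp [F]⟩
        · intro v hv
          exact ⟨SemidirectProduct.inr (f.symm ⟨v, hv⟩), by simp [F]⟩
    exact ⟨(MulEquiv.ofBijective F hF).symm⟩
  · have hcen : ∀ q, g ^ (3 * q) ∈ Subgroup.center G := by
      intro q
      have : (⊤ : Subgroup G) ≤ Subgroup.centralizer {g ^ (3 * q)} := by
        rw [← htop, sup_le_iff]
        have h4 := pow_act hV h1 h2 q
        constructor
        · intro v hv
          rw [Subgroup.mem_centralizer_iff]
          rintro _ rfl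
          rw [← mul_inv_eq_iff_eq_mul]
          change MulAut.conj (g ^ (3 * q)) v = v
          rcases (hV.mem v).1 hv with h | h | h | h <;> rw [h]
          · simp
          · exact h4.1
          · exact h4.2
          · rw [map_mul, h4.1, h4.2]
        · rw [Subgroup.zpowers_le, Subgroup.mem_centralizer_iff]
          rintro _ rfl
          rw [← pow_succ, ← pow_succ']
      rw [Subgroup.mem_center_iff]
      intro x
      exact (Subgroup.mem_centralizer_iff.1 (this (Subgroup.mem_top x)) _ rfl).symm
    have hZ : Subgroup.center G = Subgroup.zpowers (g ^ 3) := by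
      apply le_antisymm
      · intro w hw
        obtain ⟨v, hv, s, hs, rfl⟩ := Subgroup.mem_sup_of_normal_left.1
          (htop ▸ Subgroup.mem_top w : w ∈ V ⊔ Subgroup.zpowers g)
        obtain ⟨i, rfl⟩ := Submonoid.mem_powers_iff _ _ |>.1 (mem_powers_iff_mem_zpowers.2 hs)
        have hca : MulAut.conj (g ^ i) a = a := by
          have hx : MulAut.conj (v * g ^ i) a = a := by
            rw [MulAut.conj_apply, ← Subgroup.mem_center_iff.1 hw a, mul_inv_cancel_right]
          rw [map_mul, MulAut.mul_apply, MulAut.conj_apply v,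
            hV.cm hv (hn (g ^ i) a hV.ha), mul_inv_cancel_right] at hx
          exact hx
        have hi : i = 3 * (i / 3) := by
          have : i = 3 * (i / 3) ∨ i = 3 * (i / 3) + 1 ∨ i = 3 * (i / 3) + 2 := by omega
          rcases this with h | h | h
          · exact h
          · rw [h, (pow_act1 hV h1 h2 _).1] at hca
            exact absurd hca.symm hV.ab
          · rw [h, (pow_act2 hV h1 h2 _).1] at hca
            exact absurd hca hV.aba
        have hgi : g ^ i ∈ Subgroup.center G := by rw [hi]; exact hcen _
        have hvc : v ∈ Subgroup.center G := (Subgroup.mul_mem_cancel_right _ hgi).1 hw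
        have hv1 : v = 1 := by
          apply hfix v hv
          rw [MulAut.conj_apply, Subgroup.mem_center_iff.1 hvc g, mul_inv_cancel_right]
        rw [hv1, one_mul, hi, pow_mul]
        exact Subgroup.npow_mem_zpowers _ _
      · rw [Subgroup.zpowers_le]
        have := hcen 1
        rwa [mul_one] at this
    rw [hZ]
    refine ⟨inferInstance, ?_⟩
    rw [Nat.card_zpowers, orderOf_pow_of_dvd (by norm_num) (by
      rw [ho]; exact dvd_pow_self 3 (by omega)), ho]
    obtain ⟨j, rfl⟩ : ∃ j, k = j + 1 := ⟨k - 1, by omega⟩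
    rw [pow_succ]; simp

end

theorem emb2_of_lt {G : Type*} [Group G] (ρ : G →* GL (Fin 3) ℂ) (hρ : Function.Injective ρ)
    (K : Subgroup G) (hK : rdim K < 3) : Emb2 K := by
  have hne : {n : ℕ | ∃ ρ : K →* GL (Fin n) ℂ, Function.Injective ρ}.Nonempty :=
    ⟨3, ρ.comp K.subtype, hρ.comp K.subtype_injective⟩
  have hex : ∃ n, n < 3 ∧ ∃ f : K →* GL (Fin n) ℂ, Function.Injective f :=
    ⟨rdim K, hK, Nat.sInf_mem hne⟩
  obtain ⟨n, hn, f, hf⟩ := hex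
  have : n = 0 ∨ n = 1 ∨ n = 2 := by omega
  rcases this with rfl | rfl | rfl
  · refine ⟨1, fun x y _ => hf ?_⟩
    apply Units.ext
    ext i
    exact i.elim0
  · obtain ⟨j, hj⟩ := gl1_to_gl2
    exact ⟨j.comp f, hj.comp hf⟩
  · exact ⟨f, hf⟩

theorem klein_of_equiv {G : Type*} [Group G] (V : Subgroup G)
    (e : V ≃* (Multiplicative (ZMod 2) × Multiplicative (ZMod 2))) : ∃ a b, Klein V a b := by
  let p : Multiplicative (ZMod 2) × Multiplicative (ZMod 2) := (Multiplicative.ofAdd 1, 1)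
  let q : Multiplicative (ZMod 2) × Multiplicative (ZMod 2) := (1, Multiplicative.ofAdd 1)
  have hall : ∀ c : Multiplicative (ZMod 2) × Multiplicative (ZMod 2),
    c = 1 ∨ c = p ∨ c = q ∨ c = p * q := by decide
  have tr : ∀ c d, ((e.symm c : V) : G) = (e.symm d : V) → c = d := fun c d h =>
    e.symm.injective (Subtype.ext h)
  have t1 : ((e.symm 1 : V) : G) = 1 := by simp
  have tm : ∀ c d, ((e.symm (c * d) : V) : G) = (e.symm c : V) * (e.symm d : V) := fun c d => by simp
  refine ⟨(e.symm p : V), (e.symm q : V), ?_, ?_, ?_, ?_, ?_, ?_, ?_⟩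
  · intro h; rw [← t1] at h; exact absurd (tr _ _ h) (by decide)
  · intro h; rw [← t1] at h; exact absurd (tr _ _ h) (by decide)
  · intro h; exact absurd (tr _ _ h) (by decide)
  · rw [← tm, ← t1]; congr 2; decide
  · rw [← tm, ← t1]; congr 2; decide
  · rw [← tm, ← tm, mul_comm]
  · intro v
    constructor
    · intro hv
      have hs : v = (e.symm (e ⟨v, hv⟩) : V) := by simp
      rcases hall (e ⟨v, hv⟩) with h | h | h | h <;> rw [h] at hs
      · left; rw [hs, t1]
      · right; left; exact hs
      · right; right; left; exact hs
      · right; right; right; rw [hs, tm]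
    · rintro (h | h | h | h) <;> rw [h]
      · exact V.one_mem
      · exact (e.symm p).2
      · exact (e.symm q).2
      · exact V.mul_mem (e.symm p).2 (e.symm q).2

theorem stmt_12 (G : Type*) [Group G] [Finite G]
    (hna : ¬ ∀ a b : G, a * b = b * a) (h : MinFaithful G 3)
    (hV : ∃ H : Subgroup G, H ≤ commutator G ∧
      Nonempty (H ≃* (Multiplicative (ZMod 2) × Multiplicative (ZMod 2)))) :
    ∃ k : ℕ, 1 ≤ k ∧
      ∃ φ : Multiplicative (ZMod (3 ^ k)) →*
          MulAut (Multiplicative (ZMod 2) × Multiplicative (ZMod 2)),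
        Nat.card φ.range = 3 ∧
        Nonempty (G ≃* ((Multiplicative (ZMod 2) × Multiplicative (ZMod 2)) ⋊[φ]
          Multiplicative (ZMod (3 ^ k)))) ∧
        IsCyclic (Subgroup.center G) ∧ Nat.card (Subgroup.center G) = 3 ^ (k - 1) := by
  obtain ⟨hr, hsub⟩ := h
  obtain ⟨V, hVc, ⟨e⟩⟩ := hV
  obtain ⟨a, b, hK⟩ := klein_of_equiv V e
  have hmem : 3 ∈ {n : ℕ | ∃ ρ : G →* GL (Fin n) ℂ, Function.Injective ρ} := by
    have hne : {n : ℕ | ∃ ρ : G →* GL (Fin n) ℂ, Function.Injective ρ}.Nonempty :=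
      Nat.nonempty_of_pos_sInf (by change 0 < rdim G; omega)
    have := Nat.sInf_mem hne
    rwa [show sInf {n : ℕ | ∃ ρ : G →* GL (Fin n) ℂ, Function.Injective ρ} = 3 from hr] at this
  obtain ⟨ρ, hρ⟩ := hmem
  have hprop : ∀ K : Subgroup G, K ≠ ⊤ → Emb2 K := fun K hK => emb2_of_lt ρ hρ K (hsub K hK)
  have hcent : ∀ z ∈ V, z ≠ 1 → ∃ g, z * g ≠ g * z := by
    intro z hz hz1
    by_contra! hc
    exact hK.ab (gl3_central ρ hρ z (hVc hz) hc (hK.sq hz) hz1 a b (hVc hK.ha) (hVc hK.hb)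
      hK.aa hK.bb hK.a1 hK.b1)
  have hn : ∀ g, ∀ v ∈ V, MulAut.conj g v ∈ V := by
    by_cases hp : commutator G = ⊤
    · exact normal_perfect hK hprop hcent hp
    · exact normal_nonperfect hK hVc hprop hcent hp
  obtain ⟨x0, y0, g0, hK0, h10, h20⟩ := exists_cycle hK hn hcent
  obtain ⟨x, y, g, k, hK1, h1, h2, ho⟩ := three_part hK0 h10 h20
  have htop : V ⊔ Subgroup.zpowers g = ⊤ := by
    by_contra hne
    exact not_emb2 hK1 h1 h2 (hprop _ hne)
  exact ⟨k, final_step hK1 hn h1 h2 htop k ho e⟩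
end
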